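/- arXiv:math/0310441 — 7 statements merged into one kernel-verified Lean document; each statement's English description precedes it below -/
import Mathlib

section
/- Let n ≥ 2, p ≥ 1, and let A_1,…,A_{p+1} ∈ M_n(ℂ) be diagonalizable matrices with A_1 + ⋯ + A_{p+1} = 0, where A_1 has n distinct eigenvalues and the eigenvalues of the tuple of conjugacy classes are 3-generic. Then the point (A_1,…,A_{p+1}) lies in the closure, in M_n(ℂ)^{p+1}, of the set of tuples (A'_1,…,A'_{p+1}) such that each A'_j is conjugate to A_j, A'_1 + ⋯ + A'_{p+1} = 0, and the tuple (A'_1,…,A'_{p+1}) has trivial centralizer. -/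
open Polynomial BigOperators

noncomputable def rk {n : ℕ} (Y : Matrix (Fin n) (Fin n) ℂ) : ℕ :=
  ⨅ μ : ℂ, (Y - μ • (1 : Matrix (Fin n) (Fin n) ℂ)).rank

/-- The submodule of matrices commuting with `Y`. -/
noncomputable def centSub {n : ℕ} (Y : Matrix (Fin n) (Fin n) ℂ) : Submodule ℂ (Matrix (Fin n) (Fin n) ℂ) where
  carrier := {Z | Y * Z = Z * Y}
  add_mem' := by
    intro a b ha hb
    simp only [Set.mem_setOf_eq] at *
    rw [Matrix.mul_add, Matrix.add_mul, ha, hb]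
  zero_mem' := by simp
  smul_mem' := by
    intro c a ha
    simp only [Set.mem_setOf_eq] at *
    rw [Matrix.mul_smul, Matrix.smul_mul, ha]

/-- `d(Y) = n² - dim of centralizer of Y`, the dimension of the conjugacy class. -/
noncomputable def dd {n : ℕ} (Y : Matrix (Fin n) (Fin n) ℂ) : ℕ :=
  n ^ 2 - Module.finrank ℂ (centSub Y)

def SameClass {n : ℕ} (A B : Matrix (Fin n) (Fin n) ℂ) : Prop :=
  ∃ S : Matrix (Fin n) (Fin n) ℂ, IsUnit S ∧ A = S * B * S⁻¹

def IrreducibleTuple {n q : ℕ} (A : Fin q → Matrix (Fin n) (Fin n) ℂ) : Prop :=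
  ∀ W : Submodule ℂ (Fin n → ℂ), (∀ j, ∀ v ∈ W, (A j).mulVec v ∈ W) → W = ⊥ ∨ W = ⊤

def TrivialCentralizer {n q : ℕ} (A : Fin q → Matrix (Fin n) (Fin n) ℂ) : Prop :=
  ∀ Z : Matrix (Fin n) (Fin n) ℂ, (∀ j, Z * A j = A j * Z) →
    ∃ c : ℂ, Z = c • (1 : Matrix (Fin n) (Fin n) ℂ)

def HasDistinctEigenvalues {n : ℕ} (Y : Matrix (Fin n) (Fin n) ℂ) : Prop :=
  ∃ μ : Fin n → ℂ, Function.Injective μ ∧ Y.charpoly = ∏ k, (Polynomial.X - Polynomial.C (μ k))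

def IsDiagble {n : ℕ} (Y : Matrix (Fin n) (Fin n) ℂ) : Prop :=
  ∃ S : Matrix (Fin n) (Fin n) ℂ, IsUnit S ∧ ∃ d : Fin n → ℂ, Y = S * Matrix.diagonal d * S⁻¹

noncomputable def multOf {n : ℕ} (Y : Matrix (Fin n) (Fin n) ℂ) (μ : ℂ) : ℕ :=
  Module.finrank ℂ (LinearMap.ker (Y - μ • (1 : Matrix (Fin n) (Fin n) ℂ)).mulVecLin)

/-- The Sylvester map `X ↦ P X - X R`. -/
noncomputable def sylv {l m : ℕ} (P : Matrix (Fin l) (Fin l) ℂ) (R : Matrix (Fin m) (Fin m) ℂ) :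
    Matrix (Fin l) (Fin m) ℂ →ₗ[ℂ] Matrix (Fin l) (Fin m) ℂ where
  toFun Z := P * Z - Z * R
  map_add' Z W := by
    show P * (Z + W) - (Z + W) * R = (P * Z - Z * R) + (P * W - W * R)
    rw [Matrix.mul_add, Matrix.add_mul]; abel
  map_smul' c Z := by
    show P * (c • Z) - (c • Z) * R = c • (P * Z - Z * R)
    rw [Matrix.mul_smul, Matrix.smul_mul, smul_sub]

noncomputable def sDim {l m : ℕ} (P : Matrix (Fin l) (Fin l) ℂ) (R : Matrix (Fin m) (Fin m) ℂ) : ℕ :=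
  Module.finrank ℂ (LinearMap.range (sylv P R))

open Module

theorem aux_charpoly_dvd {V : Type*} [AddCommGroup V] [Module ℂ V] [FiniteDimensional ℂ V]
    (f : V →ₗ[ℂ] V) (W : Submodule ℂ V) (h : ∀ x ∈ W, f x ∈ W) :
    (f.restrict h).charpoly ∣ f.charpoly := by
  refine ⟨(W.mapQ W f h).charpoly, ?_⟩
  apply Polynomial.funext
  intro t
  rw [Polynomial.eval_mul, LinearMap.eval_charpoly, LinearMap.eval_charpoly,
    LinearMap.eval_charpoly]
  have hW : W ≤ W.comap (algebraMap ℂ (Module.End ℂ V) t - f) := by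
    intro x hx
    simp only [Submodule.mem_comap, LinearMap.sub_apply, Module.algebraMap_end_apply]
    exact W.sub_mem (W.smul_mem _ hx) (h x hx)
  rw [LinearMap.det_eq_det_mul_det W _ hW]
  congr 2
  ext x
  simp

theorem aux_multiset {α β : Type*} (g : α → β) (s : Multiset β) (t : Multiset α)
    (h : s ≤ t.map g) : ∃ u ≤ t, u.map g = s := by
  induction s using Quotient.inductionOn with | _ s
  induction t using Quotient.inductionOn with | _ t
  obtain ⟨l, h1, h2⟩ : List.Subperm s (t.map g) := h
  obtain ⟨l', h3, h4⟩ := List.sublist_map_iff.1 h2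
  refine ⟨(l' : Multiset α), h3.subperm, ?_⟩
  subst h4
  exact Quotient.sound h1

theorem aux_relation {n q : ℕ} (A : Fin q → Matrix (Fin n) (Fin n) ℂ)
    (hsum : ∑ j, A j = 0) (lam : Fin n → Fin q → ℂ)
    (hchar : ∀ j, (A j).charpoly = ∏ k, (Polynomial.X - Polynomial.C (lam k j)))
    (W : Submodule ℂ (Fin n → ℂ)) (hW : ∀ j, ∀ x ∈ W, (A j).mulVec x ∈ W) :
    ∃ Φ : Fin q → Finset (Fin n), (∀ j, (Φ j).card = finrank ℂ W) ∧
      (∑ j, ∑ k ∈ Φ j, lam k j) = 0 := by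
  have hW' : ∀ j, ∀ x ∈ W, (A j).toLin' x ∈ W := fun j x hx => by
    simpa using hW j x hx
  have key : ∀ j, ∃ Φ : Finset (Fin n), Φ.card = finrank ℂ W ∧
      ∑ k ∈ Φ, lam k j = LinearMap.trace ℂ W ((A j).toLin'.restrict (hW' j)) := by
    intro j
    have h1 := aux_charpoly_dvd (A j).toLin' W (hW' j)
    have h2 := Polynomial.roots.le_of_dvd (LinearMap.charpoly_monic _).ne_zero h1
    have h3 : (A j).toLin'.charpoly.roots = (Finset.univ.val).map (fun k => lam k j) := by
      rw [Matrix.charpoly_toLin', hchar, Polynomial.roots_prod _ _ ?_]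
      · simp
      · exact Finset.prod_ne_zero_iff.2 fun k _ => Polynomial.X_sub_C_ne_zero _
    rw [h3] at h2
    obtain ⟨u, hu, hu2⟩ := aux_multiset _ _ _ h2
    refine ⟨⟨u, Multiset.nodup_of_le hu Finset.univ.nodup⟩, ?_, ?_⟩
    · rw [Finset.card_mk, ← Multiset.card_map (fun k => lam k j) u, hu2,
        IsAlgClosed.card_roots_eq_natDegree, LinearMap.charpoly_natDegree]
    · rw [Module.End.trace_eq_sum_roots_charpoly_of_splits (IsAlgClosed.splits _), ← hu2]
      rfl
  choose Φ h1 h2 using key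
  refine ⟨Φ, h1, ?_⟩
  simp_rw [h2]
  rw [← map_sum]
  have : ∑ j, (A j).toLin'.restrict (hW' j) = 0 := by
    ext x : 2
    have := congrArg (fun M => Matrix.toLin' M (x : Fin n → ℂ)) hsum
    simp only [map_sum, LinearMap.sum_apply, map_zero, LinearMap.zero_apply] at this
    simpa [LinearMap.sum_apply] using this
  rw [this, map_zero]

/-- Matrices commuting with the tuple. -/
def centT {n q : ℕ} (A : Fin q → Matrix (Fin n) (Fin n) ℂ) :
    Submodule ℂ (Matrix (Fin n) (Fin n) ℂ) where
  carrier := {Z | ∀ j, Z * A j = A j * Z}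
  add_mem' := by
    intro a b ha hb j
    rw [Matrix.mul_add, Matrix.add_mul, ha, hb]
  zero_mem' := by simp
  smul_mem' := by
    intro c a ha j
    rw [Matrix.mul_smul, Matrix.smul_mul, ha]

theorem aux_cent_lt {n q : ℕ} (A Y : Fin q → Matrix (Fin n) (Fin n) ℂ)
    (e : Matrix (Fin n) (Fin n) ℂ) (he : e * e = e) (hcomm : ∀ j, e * A j = A j * e)
    (hC : ∀ X ∈ centT A, e * X = X * e)
    (hY1 : ∀ j, e * Y j = Y j) (hY2 : ∀ j, Y j * e = 0)
    (hns : ¬ ∃ b, e * b = b ∧ b * e = 0 ∧ ∀ j, Y j = A j * b - b * A j) :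
    finrank ℂ (centT (fun j => A j + Y j)) < finrank ℂ (centT A) := by
  have hz : ∀ Z ∈ centT (fun j => A j + Y j), Z * e = e * Z * e := by
    intro Z hZ
    have h1 : Z * e - e * Z * e ∈ centT A := by
      intro j
      have h := congrArg (fun M => (1 - e) * M * e) (hZ j)
      simp only at h
      have h2 : (1 - e) * (Z * (A j + Y j)) * e = (Z * e - e * Z * e) * A j := by
        calc _ = (1 - e) * Z * (A j * e) + (1 - e) * Z * (Y j * e) := by noncomm_ring
          _ = _ := by rw [hY2, ← hcomm]; noncomm_ring
      have h3 : (1 - e) * ((A j + Y j) * Z) * e = A j * (Z * e - e * Z * e) := by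
        calc _ = (A j - e * A j) * Z * e + (Y j - e * Y j) * Z * e := by noncomm_ring
          _ = _ := by rw [hY1, hcomm]; noncomm_ring
      rw [← h2, ← h3, h]
    have h4 := hC _ h1
    have h5 : e * (Z * e - e * Z * e) = 0 := by
      calc _ = e * Z * e - (e * e) * Z * e := by noncomm_ring
        _ = 0 := by rw [he]; simp
    have h6 : (Z * e - e * Z * e) * e = Z * e - e * Z * e := by
      calc _ = Z * (e * e) - e * Z * (e * e) := by noncomm_ring
        _ = _ := by rw [he]
    rw [h5, h6] at h4
    exact (sub_eq_zero.1 h4.symm)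
  let φ : Matrix (Fin n) (Fin n) ℂ →ₗ[ℂ] Matrix (Fin n) (Fin n) ℂ :=
    LinearMap.mulLeftRight ℂ (e, e) + LinearMap.mulLeftRight ℂ (1 - e, 1 - e)
  have hφ : ∀ Z, φ Z = e * Z * e + (1 - e) * Z * (1 - e) := fun Z => by simp [φ]
  have hφ2 : ∀ Z ∈ centT (fun j => A j + Y j), φ Z = Z - e * Z + e * Z * e := by
    intro Z hZ
    rw [hφ]
    calc _ = e * Z * e + Z - e * Z - Z * e + e * Z * e := by noncomm_ring
      _ = _ := by rw [hz Z hZ]; noncomm_ring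
  have hY3 : ∀ j, Y j * Y j = 0 := by
    intro j
    calc Y j * Y j = Y j * (e * Y j) := by rw [hY1]
      _ = (Y j * e) * Y j := by noncomm_ring
      _ = 0 := by rw [hY2, zero_mul]
  have hmap : ∀ Z ∈ centT (fun j => A j + Y j), φ Z ∈ centT A := by
    intro Z hZ j
    have h := hZ j
    simp only at h
    rw [hφ2 Z hZ]
    have hz1 := hz Z hZ
    have e1 : Z * Y j = e * Z * Y j := by
      calc Z * Y j = Z * (e * Y j) := by rw [hY1]
        _ = (Z * e) * Y j := by noncomm_ring
        _ = e * Z * (e * Y j) := by rw [hz1]; noncomm_ring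
        _ = _ := by rw [hY1]
    have e2 : Y j * Z * e = 0 := by
      calc Y j * Z * e = Y j * (Z * e) := by noncomm_ring
        _ = (Y j * e) * Z * e := by rw [hz1]; noncomm_ring
        _ = 0 := by rw [hY2]; simp
    have e3 : Z * A j - e * Z * A j = A j * Z - e * A j * Z := by
      calc Z * A j - e * Z * A j = Z * (A j + Y j) - e * (Z * (A j + Y j)) - (Z * Y j - e * Z * Y j) := by noncomm_ring
        _ = A j * Z - e * A j * Z + (Y j - e * Y j) * Z := by rw [h, e1]; noncomm_ring
        _ = _ := by rw [hY1]; noncomm_ring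
    have e4 : e * Z * e * A j = A j * e * Z * e := by
      calc e * Z * e * A j = e * Z * (e * A j) := by noncomm_ring
        _ = e * (Z * (A j + Y j)) * e - e * Z * (Y j * e) := by rw [hcomm]; noncomm_ring
        _ = (e * A j) * Z * e + e * (Y j * Z * e) := by rw [h, hY2]; noncomm_ring
        _ = _ := by rw [e2, hcomm]; noncomm_ring
    calc (Z - e * Z + e * Z * e) * A j = (Z * A j - e * Z * A j) + e * Z * e * A j := by noncomm_ring
      _ = _ := by rw [e3, e4, hcomm]; noncomm_ring
  let ψ := φ.domRestrict (centT (fun j => A j + Y j))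
  have hinj : Function.Injective ψ := by
    rw [← LinearMap.ker_eq_bot, LinearMap.ker_eq_bot']
    rintro ⟨Z, hZ⟩ h0
    replace h0 : φ Z = 0 := h0
    rw [hφ2 Z hZ] at h0
    have hz1 := hz Z hZ
    have h1 : e * Z * e = 0 := by
      have := congrArg (fun M => e * M) h0
      simp only [mul_zero] at this
      rw [← this]
      calc e * Z * e = e * Z - e * Z + e * Z * e := by noncomm_ring
        _ = e * Z - (e * e) * Z + (e * e) * Z * e := by rw [he]
        _ = _ := by noncomm_ring
    rw [h1, add_zero] at h0
    rw [h1] at hz1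
    have h2 : e * Z = Z := (sub_eq_zero.1 h0).symm
    have h3 : Z ∈ centT A := by
      intro j
      have h := hZ j
      simp only at h
      have e1 : Z * Y j = 0 := by
        calc Z * Y j = Z * (e * Y j) := by rw [hY1]
          _ = (Z * e) * Y j := by noncomm_ring
          _ = 0 := by rw [hz1, zero_mul]
      have e2 : Y j * Z = 0 := by
        calc Y j * Z = Y j * (e * Z) := by rw [h2]
          _ = (Y j * e) * Z := by noncomm_ring
          _ = 0 := by rw [hY2, zero_mul]
      rw [mul_add, add_mul, e1, e2, add_zero, add_zero] at h
      exact h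
    have h4 := hC Z h3
    rw [h2, hz1] at h4
    exact Subtype.ext h4
  rw [← LinearMap.finrank_range_of_inj hinj]
  apply Submodule.finrank_lt_finrank_of_lt
  refine lt_of_le_of_ne ?_ ?_
  · rintro _ ⟨⟨Z, hZ⟩, rfl⟩
    exact hmap Z hZ
  · intro heq
    have hee : e ∈ centT A := hcomm
    rw [← heq] at hee
    obtain ⟨⟨Z, hZ⟩, h0⟩ := hee
    replace h0 : φ Z = e := h0
    rw [hφ2 Z hZ] at h0
    have hz1 := hz Z hZ
    have h1 : e * Z * e = e := by
      have := congrArg (fun M => e * M) h0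
      simp only [he] at this
      nth_rw 3 [← this]
      calc e * Z * e = e * Z - e * Z + e * Z * e := by noncomm_ring
        _ = e * Z - (e * e) * Z + (e * e) * Z * e := by rw [he]
        _ = _ := by noncomm_ring
    rw [h1] at h0 hz1
    have h2 : Z = e * Z := by
      have : Z - e * Z = 0 := by simpa using h0
      exact sub_eq_zero.1 this
    apply hns
    refine ⟨Z - e, ?_, ?_, ?_⟩
    · rw [mul_sub, he, ← h2]
    · rw [sub_mul, he, hz1, sub_self]
    · intro j
      have h := hZ j
      simp only at h
      have e1 : Z * Y j = Y j := by
        calc Z * Y j = Z * (e * Y j) := by rw [hY1]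
          _ = (Z * e) * Y j := by noncomm_ring
          _ = _ := by rw [hz1, hY1]
      have e2 : Y j * Z = 0 := by
        calc Y j * Z = Y j * (e * Z) := by rw [← h2]
          _ = (Y j * e) * Z := by noncomm_ring
          _ = 0 := by rw [hY2, zero_mul]
      rw [mul_add, add_mul, e1, e2, add_zero] at h
      rw [mul_sub, sub_mul, hcomm, ← h]
      abel


theorem aux_sameClass {n : ℕ} (A X e : Matrix (Fin n) (Fin n) ℂ) (hcomm : e * A = A * e)
    (h1 : e * X = X) (h2 : X * e = 0) :
    SameClass (A + (A * X - X * A)) A := by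
  have hXX : X * X = 0 := by
    calc X * X = X * (e * X) := by rw [h1]
      _ = (X * e) * X := by noncomm_ring
      _ = 0 := by rw [h2, zero_mul]
  have hXAX : X * A * X = 0 := by
    calc X * A * X = X * A * (e * X) := by rw [h1]
      _ = X * (A * e) * X := by noncomm_ring
      _ = (X * e) * A * X := by rw [← hcomm]; noncomm_ring
      _ = 0 := by rw [h2]; simp
  have hinv : (1 - X) * (1 + X) = 1 := by
    calc (1 - X) * (1 + X) = 1 - X * X := by noncomm_ring
      _ = 1 := by rw [hXX, sub_zero]
  refine ⟨1 - X, IsUnit.of_mul_eq_one _ hinv, ?_⟩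
  rw [Matrix.inv_eq_right_inv hinv]
  calc A + (A * X - X * A) = A + (A * X - X * A) - X * A * X := by rw [hXAX, sub_zero]
    _ = _ := by noncomm_ring

theorem aux_simdiag {n : ℕ} (B e : Matrix (Fin n) (Fin n) ℂ) (hB : IsDiagble B)
    (he : e * e = e) (hcomm : e * B = B * e) :
    ∃ T T' : Matrix (Fin n) (Fin n) ℂ, T * T' = 1 ∧ T' * T = 1 ∧
      ∃ d ε : Fin n → ℂ, (∀ i, ε i = 0 ∨ ε i = 1) ∧ B * T = T * Matrix.diagonal d ∧
        e * T = T * Matrix.diagonal ε := by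
  obtain ⟨S, hS, δ, hBS⟩ := hB
  have hSu := (Matrix.isUnit_iff_isUnit_det _).1 hS
  let s : Set (Fin n → ℂ) :=
    {v | (∃ d : ℂ, B.mulVec v = d • v) ∧ ∃ c : ℂ, (c = 0 ∨ c = 1) ∧ e.mulVec v = c • v}
  have hspan : ⊤ ≤ Submodule.span ℂ s := by
    intro v _
    have hv : v = S.mulVec (S⁻¹.mulVec v) := by
      rw [Matrix.mulVec_mulVec, Matrix.mul_nonsing_inv _ hSu, Matrix.one_mulVec]
    rw [hv, Matrix.mulVec_eq_sum]
    refine Submodule.sum_mem (Submodule.span ℂ s) fun k _ => ?_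
    rw [op_smul_eq_smul]
    refine Submodule.smul_mem (Submodule.span ℂ s) _ ?_
    have hBS' : B * S = S * Matrix.diagonal δ := by
      rw [hBS, Matrix.mul_assoc, Matrix.nonsing_inv_mul _ hSu, Matrix.mul_one]
    have hk : B.mulVec (S.transpose k) = δ k • S.transpose k := by
      ext i
      have := congrFun (congrFun hBS' i) k
      rw [Matrix.mul_diagonal] at this
      simp only [Pi.smul_apply, Matrix.transpose_apply, smul_eq_mul]
      rw [mul_comm, ← this]
      rfl
    have hd : S.transpose k = e.mulVec (S.transpose k) + (S.transpose k - e.mulVec (S.transpose k)) := by abel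
    have hBe : B.mulVec (e.mulVec (S.transpose k)) = δ k • e.mulVec (S.transpose k) := by
      rw [Matrix.mulVec_mulVec, ← hcomm, ← Matrix.mulVec_mulVec, hk, Matrix.mulVec_smul]
    rw [hd]
    refine Submodule.add_mem _ (Submodule.subset_span ?_) (Submodule.subset_span ?_)
    · exact ⟨⟨δ k, hBe⟩, 1, Or.inr rfl, by rw [Matrix.mulVec_mulVec, he, one_smul]⟩
    · refine ⟨⟨δ k, ?_⟩, 0, Or.inl rfl, ?_⟩
      · rw [Matrix.mulVec_sub, hk, hBe, smul_sub]
      · rw [Matrix.mulVec_sub, Matrix.mulVec_mulVec, he, sub_self, zero_smul]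
  let b0 := Module.Basis.ofSpan hspan
  have : Fintype ((linearIndepOn_empty ℂ id).extend (Set.empty_subset s)) :=
    FiniteDimensional.fintypeBasisIndex b0
  have hcard : Fintype.card ((linearIndepOn_empty ℂ id).extend (Set.empty_subset s)) = n := by
    rw [← Module.finrank_eq_card_basis b0]; simp
  let b := b0.reindex (Fintype.equivFinOfCardEq hcard)
  have hb : ∀ i, b i ∈ s := by
    intro i
    simp only [b, Module.Basis.reindex_apply]
    exact Module.Basis.ofSpan_subset hspan ⟨_, rfl⟩
  choose hb1 hb2 using hb
  choose d hd using hb1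
  choose ε hε1 hε2 using hb2
  let T : Matrix (Fin n) (Fin n) ℂ := Matrix.of fun i k => b k i
  have hT : T = (Pi.basisFun ℂ (Fin n)).toMatrix b := by
    ext i k; simp [T, Module.Basis.toMatrix_apply]
  refine ⟨T, b.toMatrix (Pi.basisFun ℂ (Fin n)), ?_, ?_, d, ε, hε1, ?_, ?_⟩
  · rw [hT, Module.Basis.toMatrix_mul_toMatrix_flip]
  · rw [hT, Module.Basis.toMatrix_mul_toMatrix_flip]
  · ext i k
    rw [Matrix.mul_diagonal, mul_comm]
    exact congrFun (hd k) i
  · ext i k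
    rw [Matrix.mul_diagonal, mul_comm]
    exact congrFun (hε2 k) i

theorem aux_rank_map {n : ℕ} (T T' : Matrix (Fin n) (Fin n) ℂ) (h1 : T * T' = 1) (h2 : T' * T = 1)
    (G : Matrix (Fin n) (Fin n) ℂ →ₗ[ℂ] Matrix (Fin n) (Fin n) ℂ) (w : Fin n × Fin n → ℂ)
    (hG : ∀ X i k, (T' * G X * T) i k = w (i, k) * (T' * X * T) i k) :
    finrank ℂ (LinearMap.range G) = (Finset.univ.filter fun x => w x ≠ 0).card := by
  classical
  let c : Matrix (Fin n) (Fin n) ℂ ≃ₗ[ℂ] (Fin n × Fin n → ℂ) :=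
    { toFun := fun X x => (T' * X * T) x.1 x.2
      invFun := fun g => T * Matrix.of (fun i k => g (i, k)) * T'
      map_add' := by intro X Y; ext x; simp [Matrix.mul_add, Matrix.add_mul]
      map_smul' := by intro X Y; ext x; simp
      left_inv := by
        intro X
        have : Matrix.of (fun i k => (T' * X * T) i k) = T' * X * T := rfl
        simp only [this]
        calc T * (T' * X * T) * T' = (T * T') * X * (T * T') := by noncomm_ring
          _ = X := by rw [h1]; simp
      right_inv := by
        intro g
        ext x
        have : T' * (T * Matrix.of (fun i k => g (i, k)) * T') * T =
            Matrix.of (fun i k => g (i, k)) := by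
          calc _ = (T' * T) * Matrix.of (fun i k => g (i, k)) * (T' * T) := by noncomm_ring
            _ = _ := by rw [h2]; simp
        simp only [this]; rfl }
  have hc : c.toLinearMap ∘ₗ G = (Matrix.diagonal w).mulVecLin ∘ₗ c.toLinearMap := by
    ext1 X
    funext x
    simp only [LinearMap.comp_apply, Matrix.mulVecLin_apply, Matrix.mulVec_diagonal]
    exact hG X x.1 x.2
  have h3 : finrank ℂ (LinearMap.range (c.toLinearMap ∘ₗ G)) = finrank ℂ (LinearMap.range G) := by
    rw [LinearMap.range_comp]
    exact LinearEquiv.finrank_map_eq c _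
  rw [← h3, hc, LinearMap.range_comp_of_range_eq_top _ (LinearEquiv.range c)]
  have := Matrix.rank_diagonal w
  rw [Matrix.rank] at this
  rw [this, Fintype.card_subtype]

theorem aux_rank_conj {n : ℕ} (T T' B : Matrix (Fin n) (Fin n) ℂ) (h1 : T * T' = 1)
    (w : Fin n → ℂ) (hB : B * T = T * Matrix.diagonal w) :
    B.rank = (Finset.univ.filter fun i => w i ≠ 0).card := by
  classical
  have hT : IsUnit T.det := (Matrix.isUnit_iff_isUnit_det _).1 (IsUnit.of_mul_eq_one _ h1)
  rw [← Matrix.rank_mul_eq_left_of_isUnit_det T B hT, hB,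
    Matrix.rank_mul_eq_right_of_isUnit_det T _ hT, Matrix.rank_diagonal, Fintype.card_subtype]

theorem aux_rank_sum {n p : ℕ} (B : Fin p → Matrix (Fin n) (Fin n) ℂ) (s : Finset (Fin p)) :
    (∑ j ∈ s, B j).rank ≤ ∑ j ∈ s, (B j).rank := by
  classical
  induction s using Finset.induction_on with
  | empty => simp
  | insert a s ha ih =>
    rw [Finset.sum_insert ha, Finset.sum_insert ha]
    have : (B a + ∑ j ∈ s, B j).rank ≤ (B a).rank + (∑ j ∈ s, B j).rank := by
      unfold Matrix.rank
      rw [Matrix.mulVecLin_add]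
      refine le_trans (Submodule.finrank_mono (t := LinearMap.range (B a).mulVecLin ⊔
        LinearMap.range (∑ j ∈ s, B j).mulVecLin) ?_) (Submodule.finrank_add_le_finrank_add_finrank _ _)
      exact LinearMap.range_add_le _ _
    omega


theorem aux_avg {p n l m : ℕ} (F : Fin p → Finset (Fin n)) (hm : 0 < m)
    (hF : ∀ j, (F j).card = m) (c : Fin p → Fin n → ℕ)
    (h : ∀ κ : Fin p → Fin n, l ≤ ∑ j, c j (κ j))
    (hs : ∑ j, ∑ k ∈ F j, c j k ≤ l * m) :
    ∃ c0 : Fin p → ℕ, (∀ j, ∀ k ∈ F j, c j k = c0 j) ∧ ∑ j, c0 j = l := by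
  have h1 : ∀ j, ∃ k ∈ F j, ∀ k' ∈ F j, c j k ≤ c j k' := fun j =>
    Finset.exists_min_image (F j) (c j) (Finset.card_pos.1 (by rw [hF]; exact hm))
  choose κ hκ hmin using h1
  have h2 := h κ
  have h3 : ∑ j, ∑ k ∈ F j, c j (κ j) = (∑ j, c j (κ j)) * m := by
    rw [Finset.sum_mul]
    refine Finset.sum_congr rfl fun j _ => ?_
    rw [Finset.sum_const, hF, smul_eq_mul, mul_comm]
  have h4 : ∀ j ∈ Finset.univ, ∑ k ∈ F j, c j (κ j) ≤ ∑ k ∈ F j, c j k := fun j _ =>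
    Finset.sum_le_sum fun k hk => hmin j k hk
  have h5 := Finset.sum_le_sum h4
  have h6 : l * m ≤ (∑ j, c j (κ j)) * m := Nat.mul_le_mul_right _ h2
  have h7 : ∑ j, ∑ k ∈ F j, c j (κ j) = ∑ j, ∑ k ∈ F j, c j k := by omega
  refine ⟨fun j => c j (κ j), ?_, ?_⟩
  · intro j k hk
    have h8 := (Finset.sum_eq_sum_iff_of_le h4).1 h7 j (Finset.mem_univ _)
    exact ((Finset.sum_eq_sum_iff_of_le (fun k hk => hmin j k hk)).1 h8 k hk).symm
  · have : (∑ j, c j (κ j)) * m = l * m := by omega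
    exact Nat.eq_of_mul_eq_mul_right hm this

theorem aux_comb {p n l m : ℕ} (E F : Fin p → Finset (Fin n)) (d : Fin p → Fin n → ℂ)
    (hl : 0 < l) (hm : 0 < m) (hE : ∀ j, (E j).card = l) (hF : ∀ j, (F j).card = m)
    (h1 : ∀ κ : Fin p → Fin n, l ≤ ∑ j, ((E j).filter fun i => d j i ≠ d j (κ j)).card)
    (h2 : ∀ κ : Fin p → Fin n, m ≤ ∑ j, ((F j).filter fun k => d j k ≠ d j (κ j)).card)
    (h3 : ∑ j, ((E j ×ˢ F j).filter fun x => d j x.1 ≠ d j x.2).card ≤ l * m) :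
    ∃ j1 j2 : Fin p, j1 ≠ j2 ∧ ∃ μ ν : Fin p → ℂ,
      (∀ j, ∀ i ∈ E j, d j i = μ j ∨ d j i = ν j) ∧
      (∀ j, j ≠ j1 → j ≠ j2 → ∀ i ∈ E j, d j i = μ j) := by
  classical
  have s1 : ∀ j, ((E j ×ˢ F j).filter fun x => d j x.1 ≠ d j x.2).card =
      ∑ k ∈ F j, ((E j).filter fun i => d j i ≠ d j k).card := by
    intro j
    simp only [Finset.card_filter]
    rw [Finset.sum_product_right]
  have s2 : ∀ j, ((E j ×ˢ F j).filter fun x => d j x.1 ≠ d j x.2).card =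
      ∑ i ∈ E j, ((F j).filter fun k => d j k ≠ d j i).card := by
    intro j
    simp only [Finset.card_filter]
    rw [Finset.sum_product]
    simp only [ne_comm]
  obtain ⟨c, hc, hcs⟩ := aux_avg F hm hF
    (fun j k => ((E j).filter fun i => d j i ≠ d j k).card) h1
    ((Finset.sum_congr rfl fun j _ => (s1 j).symm).trans_le h3)
  obtain ⟨c', hc', hcs'⟩ := aux_avg E hl hE
    (fun j i => ((F j).filter fun k => d j k ≠ d j i).card) h2
    (((Finset.sum_congr rfl fun j _ => (s2 j).symm).trans_le h3).trans_eq (mul_comm l m))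
  have hcc : ∀ j, m * c j = l * c' j := by
    intro j
    have e1 := s1 j
    rw [s2 j, Finset.sum_congr rfl (hc j), Finset.sum_congr rfl (hc' j)] at e1
    simp only [Finset.sum_const, hE, hF, smul_eq_mul] at e1
    exact e1.symm
  have hFn : ∀ j, ∃ k, k ∈ F j := fun j => Finset.card_pos.1 (by rw [hF]; exact hm)
  have hEn : ∀ j, ∃ k, k ∈ E j := fun j => Finset.card_pos.1 (by rw [hE]; exact hl)
  choose k0 hk0 using hFn
  choose i0 hi0 using hEn
  have hcl : ∀ j, c j < l := by
    intro j
    by_contra hge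
    push Not at hge
    have hsp := Finset.add_sum_erase Finset.univ c (Finset.mem_univ j)
    have hk := h1 (Function.update k0 j (i0 j))
    rw [← Finset.add_sum_erase _ _ (Finset.mem_univ j)] at hk
    have e1 : ∑ x ∈ Finset.univ.erase j,
        ((E x).filter fun i => d x i ≠ d x (Function.update k0 j (i0 j) x)).card =
        ∑ x ∈ Finset.univ.erase j, c x := by
      refine Finset.sum_congr rfl fun x hx => ?_
      rw [Function.update_of_ne (Finset.ne_of_mem_erase hx)]
      exact hc x _ (hk0 x)
    rw [e1, Function.update_self] at hk
    have e2 : ((E j).filter fun i => d j i ≠ d j (i0 j)).card < (E j).card := by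
      apply Finset.card_lt_card
      refine Finset.filter_ssubset.2 ⟨i0 j, hi0 j, by simp⟩
    rw [hE] at e2
    omega
  have hcl' : ∀ j, c' j < m := by
    intro j
    have e1 := hcc j
    have e2 : m * c j < m * l := Nat.mul_lt_mul_of_pos_left (hcl j) hm
    rw [e1, mul_comm m l] at e2
    exact Nat.lt_of_mul_lt_mul_left e2
  have hsplit : ∀ j (z : ℂ), ((E j).filter fun i => d j i = z).card +
      ((E j).filter fun i => d j i ≠ z).card = l := by
    intro j z
    rw [← hE j]
    exact Finset.card_filter_add_card_filter_not _
  -- zero case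
  have hzero : ∀ j, c j = 0 → ∀ i ∈ E j, d j i = d j (k0 j) := by
    intro j hj i hi
    have := hc j (k0 j) (hk0 j)
    rw [hj, Finset.card_eq_zero, Finset.filter_eq_empty_iff] at this
    simpa using this hi
  have hnz : ∀ j, c j ≠ 0 → l ≤ 2 * c j ∧ ∃ ν : ℂ, (2 * c j = l → ∀ i ∈ E j, d j i = d j (k0 j) ∨ d j i = ν) := by
    intro j hj
    have e1 := hc j (k0 j) (hk0 j)
    have e2 : ((E j).filter fun i => d j i ≠ d j (k0 j)).Nonempty := by
      apply Finset.card_pos.1; rw [e1]; omega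
    obtain ⟨i1, hi1⟩ := e2
    rw [Finset.mem_filter] at hi1
    have e3 := hc' j i1 hi1.1
    have e4 : ∃ k1 ∈ F j, d j k1 = d j i1 := by
      by_contra hcon
      push Not at hcon
      rw [Finset.filter_true_of_mem hcon, hF] at e3
      have := hcl' j
      omega
    obtain ⟨k1, hk1, hk1'⟩ := e4
    have e5 := hc j k1 hk1
    have f1 := hsplit j (d j (k0 j))
    have f2 := hsplit j (d j k1)
    have hdis : Disjoint ((E j).filter fun i => d j i = d j (k0 j)) ((E j).filter fun i => d j i = d j k1) := by
      rw [Finset.disjoint_filter]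
      intro x _ hx hx'
      exact hi1.2 (by rw [← hk1', ← hx', hx])
    have hun := Finset.card_union_of_disjoint hdis
    have hsub : ((E j).filter fun i => d j i = d j (k0 j)) ∪ ((E j).filter fun i => d j i = d j k1) ⊆ E j :=
      Finset.union_subset (Finset.filter_subset _ _) (Finset.filter_subset _ _)
    have hle := Finset.card_le_card hsub
    rw [hE] at hle
    refine ⟨by omega, d j k1, ?_⟩
    intro h2c i hi
    have heq := Finset.eq_of_subset_of_card_le hsub (by rw [hE]; omega)
    rw [← heq] at hi
    rcases Finset.mem_union.1 hi with h | h
    · exact Or.inl (Finset.mem_filter.1 h).2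
    · exact Or.inr (Finset.mem_filter.1 h).2
  -- counting
  have hJ : ∃ j1, c j1 ≠ 0 := by
    by_contra hcon
    push Not at hcon
    simp [hcon] at hcs
    omega
  obtain ⟨j1, hj1⟩ := hJ
  have hJ2 : ∃ j2, j2 ≠ j1 ∧ c j2 ≠ 0 := by
    by_contra hcon
    push Not at hcon
    rw [Finset.sum_eq_single j1 (fun b _ hb => hcon b hb) (by simp)] at hcs
    have := hcl j1
    omega
  obtain ⟨j2, hj12, hj2⟩ := hJ2
  have t1 := Finset.add_sum_erase Finset.univ c (Finset.mem_univ j1)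
  have t2 := Finset.add_sum_erase (Finset.univ.erase j1) c
    (Finset.mem_erase.2 ⟨hj12, Finset.mem_univ _⟩)
  have u1 := (hnz j1 hj1).1
  have u2 := (hnz j2 hj2).1
  have t3 : ∑ x ∈ (Finset.univ.erase j1).erase j2, c x = 0 := by omega
  have hoth : ∀ j, j ≠ j1 → j ≠ j2 → c j = 0 := by
    intro j a b
    exact Finset.sum_eq_zero_iff.1 t3 j (by simp [a, b])
  have hν : ∀ j, ∃ ν : ℂ, ∀ i ∈ E j, d j i = d j (k0 j) ∨ d j i = ν := by
    intro j
    by_cases hj : c j = 0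
    · exact ⟨0, fun i hi => Or.inl (hzero j hj i hi)⟩
    · obtain ⟨ν, hν⟩ := (hnz j hj).2
      refine ⟨ν, hν ?_⟩
      by_cases a : j = j1
      · subst a; omega
      · by_cases b : j = j2
        · subst b; omega
        · exact absurd (hoth j a b) hj
  choose ν hν using hν
  exact ⟨j1, j2, hj12.symm, fun j => d j (k0 j), ν, hν, fun j a b => hzero j (hoth j a b)⟩


/-- Projection onto the off-diagonal block. -/
noncomputable def piL {n : ℕ} (e : Matrix (Fin n) (Fin n) ℂ) :
    Matrix (Fin n) (Fin n) ℂ →ₗ[ℂ] Matrix (Fin n) (Fin n) ℂ :=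
  LinearMap.mulLeftRight ℂ (e, 1 - e)

/-- The commutator map. -/
noncomputable def adL {n : ℕ} (B : Matrix (Fin n) (Fin n) ℂ) :
    Matrix (Fin n) (Fin n) ℂ →ₗ[ℂ] Matrix (Fin n) (Fin n) ℂ :=
  LinearMap.mulLeft ℂ B - LinearMap.mulRight ℂ B

theorem piL_apply {n : ℕ} (e X : Matrix (Fin n) (Fin n) ℂ) : piL e X = e * X * (1 - e) := by
  simp [piL]

theorem adL_apply {n : ℕ} (B X : Matrix (Fin n) (Fin n) ℂ) : adL B X = B * X - X * B := by
  simp [adL]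

theorem mem_range_piL {n : ℕ} (e X : Matrix (Fin n) (Fin n) ℂ) (he : e * e = e) :
    X ∈ LinearMap.range (piL e) ↔ e * X = X ∧ X * e = 0 := by
  constructor
  · rintro ⟨Z, rfl⟩
    rw [piL_apply]
    constructor
    · calc e * (e * Z * (1 - e)) = (e * e) * Z * (1 - e) := by noncomm_ring
        _ = _ := by rw [he]
    · calc e * Z * (1 - e) * e = e * Z * (e - e * e) := by noncomm_ring
        _ = 0 := by rw [he]; simp
  · rintro ⟨h1, h2⟩
    refine ⟨X, ?_⟩
    rw [piL_apply, h1, mul_sub, h2]; simp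

theorem adL_mem {n : ℕ} (e B X : Matrix (Fin n) (Fin n) ℂ) (he : e * e = e) (hB : e * B = B * e)
    (hX : X ∈ LinearMap.range (piL e)) : adL B X ∈ LinearMap.range (piL e) := by
  rw [mem_range_piL e _ he] at hX ⊢
  obtain ⟨h1, h2⟩ := hX
  rw [adL_apply]
  constructor
  · calc e * (B * X - X * B) = (e * B) * X - (e * X) * B := by noncomm_ring
      _ = B * (e * X) - (e * X) * B := by rw [hB]; noncomm_ring
      _ = _ := by rw [h1]
  · calc (B * X - X * B) * e = B * (X * e) - X * (B * e) := by noncomm_ring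
      _ = B * (X * e) - (X * e) * B := by rw [← hB]; noncomm_ring
      _ = 0 := by rw [h2]; simp

theorem aux_dim {n p : ℕ} (A : Fin (p + 1) → Matrix (Fin n) (Fin n) ℂ)
    (e : Matrix (Fin n) (Fin n) ℂ) (he : e * e = e) (hcomm : ∀ j, e * A j = A j * e)
    (hC0 : ∀ X, X * A 0 = A 0 * X → e * X = X * e)
    (H : ∀ X : Fin (p + 1) → Matrix (Fin n) (Fin n) ℂ, (∀ j, e * X j = X j) →
      (∀ j, X j * e = 0) → ∑ j, (A j * X j - X j * A j) = 0 →
      ∃ b, e * b = b ∧ b * e = 0 ∧ ∀ j, A j * X j - X j * A j = A j * b - b * A j) :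
    ∑ j : Fin p, finrank ℂ (LinearMap.range (adL (A j.succ) ∘ₗ piL e)) ≤
      finrank ℂ (LinearMap.range (piL e)) := by
  have hsurj0 : ∀ V ∈ LinearMap.range (piL e), ∃ X ∈ LinearMap.range (piL e), adL (A 0) X = V := by
    let a0 := (adL (A 0)).restrict (p := LinearMap.range (piL e)) (q := LinearMap.range (piL e))
      (fun X hX => adL_mem e (A 0) X he (hcomm 0) hX)
    have hinj : Function.Injective a0 := by
      rw [← LinearMap.ker_eq_bot, LinearMap.ker_eq_bot']
      rintro ⟨X, hX⟩ h0
      have h1 : adL (A 0) X = 0 := congrArg Subtype.val h0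
      rw [adL_apply, sub_eq_zero] at h1
      have h2 := hC0 X h1.symm
      rw [mem_range_piL e _ he] at hX
      rw [hX.1, hX.2] at h2
      exact Subtype.ext h2
    have hs := LinearMap.injective_iff_surjective.1 hinj
    intro V hV
    obtain ⟨⟨X, hX⟩, h⟩ := hs ⟨V, hV⟩
    exact ⟨X, hX, congrArg Subtype.val h⟩
  let Ψ : LinearMap.range (piL e) →ₗ[ℂ] (∀ j : Fin p, LinearMap.range (adL (A j.succ) ∘ₗ piL e)) :=
    LinearMap.pi fun j => ((adL (A j.succ)).comp (LinearMap.range (piL e)).subtype).codRestrict _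
      (by rintro ⟨_, X, rfl⟩; exact ⟨X, rfl⟩)
  have hΨ : Function.Surjective Ψ := by
    intro g
    have hg : ∀ j, ∃ X ∈ LinearMap.range (piL e), adL (A j.succ) X = (g j : Matrix (Fin n) (Fin n) ℂ) := by
      intro j
      obtain ⟨X, hX⟩ := (g j).2
      exact ⟨piL e X, ⟨X, rfl⟩, hX⟩
    choose X hX1 hX2 using hg
    have hV : -∑ j, adL (A j.succ) (X j) ∈ LinearMap.range (piL e) :=
      Submodule.neg_mem _ (Submodule.sum_mem _ fun j _ => adL_mem e _ _ he (hcomm _) (hX1 j))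
    obtain ⟨X0, hX0, hX0'⟩ := hsurj0 _ hV
    have hall : ∀ j, (Fin.cons X0 X : Fin (p + 1) → Matrix (Fin n) (Fin n) ℂ) j ∈
        LinearMap.range (piL e) := by
      intro j
      refine Fin.cases ?_ (fun j => ?_) j
      · simpa using hX0
      · simpa using hX1 j
    obtain ⟨b, hb1, hb2, hb3⟩ := H (Fin.cons X0 X)
      (fun j => ((mem_range_piL e _ he).1 (hall j)).1)
      (fun j => ((mem_range_piL e _ he).1 (hall j)).2) (by
        rw [Fin.sum_univ_succ]
        simp only [Fin.cons_zero, Fin.cons_succ, ← adL_apply]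
        rw [hX0', neg_add_cancel])
    refine ⟨⟨b, (mem_range_piL e b he).2 ⟨hb1, hb2⟩⟩, ?_⟩
    funext j
    apply Subtype.ext
    rw [← hX2 j]
    have := hb3 j.succ
    simp only [Fin.cons_succ, ← adL_apply] at this
    exact this.symm
  have := LinearMap.finrank_le_finrank_of_surjective hΨ
  rwa [Module.finrank_pi_fintype] at this

theorem aux_rkbound {n p : ℕ} (A : Fin (p + 1) → Matrix (Fin n) (Fin n) ℂ)
    (hsum : ∑ j, A j = 0) (lam : Fin n → Fin (p + 1) → ℂ)
    (hchar : ∀ j, (A j).charpoly = ∏ k, (Polynomial.X - Polynomial.C (lam k j)))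
    (h1gen : ∀ κ : Fin (p + 1) → Fin n, ∑ j, lam (κ j) j ≠ 0)
    (μ : Fin p → ℂ) (hμ : ∀ j, (A j.succ).charpoly.eval (μ j) = 0)
    (g : Matrix (Fin n) (Fin n) ℂ) :
    g.rank ≤ ∑ j : Fin p, ((A j.succ - μ j • (1 : Matrix (Fin n) (Fin n) ℂ)) * g).rank := by
  have hroot : ∀ j t, (A j).charpoly.eval t = 0 → ∃ k, t = lam k j := by
    intro j t ht
    rw [hchar, Polynomial.eval_prod, Finset.prod_eq_zero_iff] at ht
    obtain ⟨k, _, hk⟩ := ht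
    exact ⟨k, by simpa [sub_eq_zero] using hk⟩
  choose κ hκ using fun j => hroot _ _ (hμ j)
  have hdet : (Matrix.scalar (Fin n) (-∑ j, μ j) - A 0).det ≠ 0 := by
    rw [← Matrix.eval_charpoly]
    intro h0
    obtain ⟨k, hk⟩ := hroot _ _ h0
    apply h1gen (Fin.cons k κ)
    rw [Fin.sum_univ_succ]
    simp only [Fin.cons_zero, Fin.cons_succ, ← hκ, ← hk, neg_add_cancel]
  have heq : Matrix.scalar (Fin n) (-∑ j, μ j) - A 0 =
      ∑ j : Fin p, (A j.succ - μ j • (1 : Matrix (Fin n) (Fin n) ℂ)) := by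
    rw [Fin.sum_univ_succ] at hsum
    have hsc : Matrix.scalar (Fin n) (-∑ j, μ j) =
        -((∑ j, μ j) • (1 : Matrix (Fin n) (Fin n) ℂ)) := by
      rw [← neg_smul, Matrix.smul_one_eq_diagonal]
      rfl
    rw [eq_neg_of_add_eq_zero_left hsum, Finset.sum_sub_distrib, ← Finset.sum_smul, hsc]
    abel
  calc g.rank = ((Matrix.scalar (Fin n) (-∑ j, μ j) - A 0) * g).rank :=
        (Matrix.rank_mul_eq_right_of_isUnit_det _ _ (isUnit_iff_ne_zero.2 hdet)).symm
    _ ≤ _ := by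
      rw [heq, Finset.sum_mul]
      exact aux_rank_sum _ _

theorem aux_inv_sub {n p : ℕ} (A : Fin (p + 1) → Matrix (Fin n) (Fin n) ℂ)
    (hsum : ∑ j, A j = 0) (R : Submodule ℂ (Fin n → ℂ))
    (hR : ∀ j, ∀ v ∈ R, (A j).mulVec v ∈ R)
    (x : Fin n → ℂ) (hxR : x ∈ R) (θ : ℂ) (hθ : (A 0).mulVec x = θ • x)
    (j1 j2 : Fin p) (hj : j1 ≠ j2) (μ ν : Fin p → ℂ)
    (h1 : ∀ j, j ≠ j1 → j ≠ j2 → ∀ v ∈ R, (A j.succ).mulVec v = μ j • v)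
    (h2 : ∀ j, ∀ v ∈ R, (A j.succ).mulVec ((A j.succ).mulVec v) =
      (μ j + ν j) • (A j.succ).mulVec v - (μ j * ν j) • v) :
    ∀ j, ∀ v ∈ Submodule.span ℂ {x, (A j1.succ).mulVec x},
      (A j).mulVec v ∈ Submodule.span ℂ {x, (A j1.succ).mulVec x} := by
  classical
  set W := Submodule.span ℂ {x, (A j1.succ).mulVec x} with hWdef
  have hx : x ∈ W := Submodule.subset_span (by simp)
  have hax : (A j1.succ).mulVec x ∈ W := Submodule.subset_span (by simp)
  have hWR : W ≤ R := by
    rw [hWdef, Submodule.span_le]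
    intro v hv
    simp only [Set.mem_insert_iff, Set.mem_singleton_iff] at hv
    rcases hv with rfl | rfl
    · exact hxR
    · exact hR _ _ hxR
  have hstep : ∀ B : Matrix (Fin n) (Fin n) ℂ, B.mulVec x ∈ W →
      B.mulVec ((A j1.succ).mulVec x) ∈ W → ∀ v ∈ W, B.mulVec v ∈ W := by
    intro B hB1 hB2 v hv
    have : W ≤ W.comap B.mulVecLin := by
      conv_lhs => rw [hWdef]
      rw [Submodule.span_le]
      intro v hv
      simp only [Set.mem_insert_iff, Set.mem_singleton_iff] at hv
      rcases hv with rfl | rfl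
      · exact hB1
      · exact hB2
    exact this hv
  have hoth : ∀ j, j ≠ j1 → j ≠ j2 → ∀ v ∈ W, (A j.succ).mulVec v ∈ W := by
    intro j a b v hv
    rw [h1 j a b v (hWR hv)]
    exact W.smul_mem _ hv
  have hA1 : ∀ v ∈ W, (A j1.succ).mulVec v ∈ W := by
    apply hstep _ hax
    rw [h2 j1 x hxR]
    exact W.sub_mem (W.smul_mem _ hax) (W.smul_mem _ hx)
  have hsumv : ∀ v, (A 0).mulVec v + ((A j1.succ).mulVec v + ((A j2.succ).mulVec v +
      ∑ j ∈ (Finset.univ.erase j1).erase j2, (A j.succ).mulVec v)) = 0 := by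
    intro v
    rw [Finset.add_sum_erase _ (fun j : Fin p => (A j.succ).mulVec v) (by simp [hj.symm]),
      Finset.add_sum_erase _ (fun j : Fin p => (A j.succ).mulVec v) (by simp),
      ← Fin.sum_univ_succ (fun j => (A j).mulVec v), ← Matrix.sum_mulVec, hsum, Matrix.zero_mulVec]
  have hrest : ∀ v ∈ W, ∑ j ∈ (Finset.univ.erase j1).erase j2, (A j.succ).mulVec v =
      (∑ j ∈ (Finset.univ.erase j1).erase j2, μ j) • v := by
    intro v hv
    rw [Finset.sum_smul]
    refine Finset.sum_congr rfl fun j hj' => ?_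
    simp only [Finset.mem_erase, Finset.mem_univ, and_true] at hj'
    exact h1 j hj'.2 hj'.1 v (hWR hv)
  set c := ∑ j ∈ (Finset.univ.erase j1).erase j2, μ j
  have hBx : (A j1.succ).mulVec x = (-θ - c) • x - (A j2.succ).mulVec x := by
    have := hsumv x
    rw [hrest x hx, hθ] at this
    rw [← sub_eq_zero, ← this, sub_smul, neg_smul]
    abel
  have hbx : (A j2.succ).mulVec x ∈ W := by
    have : (A j2.succ).mulVec x = (-θ - c) • x - (A j1.succ).mulVec x := by
      rw [hBx]; abel
    rw [this]
    exact W.sub_mem (W.smul_mem _ hx) hax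
  have hA2 : ∀ v ∈ W, (A j2.succ).mulVec v ∈ W := by
    apply hstep _ hbx
    rw [hBx, Matrix.mulVec_sub, Matrix.mulVec_smul, h2 j2 x hxR]
    exact W.sub_mem (W.smul_mem _ hbx) (W.sub_mem (W.smul_mem _ hbx) (W.smul_mem _ hx))
  have hsucc : ∀ j : Fin p, ∀ v ∈ W, (A j.succ).mulVec v ∈ W := by
    intro j
    by_cases a : j = j1
    · rw [a]; exact hA1
    · by_cases b : j = j2
      · rw [b]; exact hA2
      · exact hoth j a b
  intro j
  refine Fin.cases ?_ hsucc j
  intro v hv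
  rw [eq_neg_of_add_eq_zero_left (hsumv v)]
  exact W.neg_mem (W.add_mem (hsucc _ v hv) (W.add_mem (hsucc _ v hv)
    (W.sum_mem fun j _ => hsucc j v hv)))


theorem aux_rank_zero {n : ℕ} (B : Matrix (Fin n) (Fin n) ℂ) (h : B.rank = 0) : B = 0 := by
  rw [Matrix.rank, Submodule.finrank_eq_zero, LinearMap.range_eq_bot] at h
  apply Matrix.mulVec_injective
  funext v
  have := LinearMap.congr_fun h v
  simpa using this

theorem aux_nonsplit {n p : ℕ} (hn : 2 ≤ n)
    (A : Fin (p + 1) → Matrix (Fin n) (Fin n) ℂ)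
    (hdiag : ∀ j, IsDiagble (A j))
    (hsum : ∑ j, A j = 0)
    (lam : Fin n → Fin (p + 1) → ℂ)
    (hchar : ∀ j, (A j).charpoly = ∏ k, (Polynomial.X - Polynomial.C (lam k j)))
    (h3gen : ∀ (N : ℕ) (Φ : Fin (p + 1) → Finset (Fin n)),
      1 ≤ N → N ≤ n - 1 → (∀ j, (Φ j).card = N) →
      (∑ j, ∑ k ∈ Φ j, lam k j) = 0 → 3 ≤ min N (n - N))
    (e : Matrix (Fin n) (Fin n) ℂ) (he : e * e = e) (he0 : e ≠ 0) (he1 : e ≠ 1)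
    (hcomm : ∀ j, e * A j = A j * e)
    (hC0 : ∀ X, X * A 0 = A 0 * X → e * X = X * e)
    (H : ∀ X : Fin (p + 1) → Matrix (Fin n) (Fin n) ℂ, (∀ j, e * X j = X j) →
      (∀ j, X j * e = 0) → ∑ j, (A j * X j - X j * A j) = 0 →
      ∃ b, e * b = b ∧ b * e = 0 ∧ ∀ j, A j * X j - X j * A j = A j * b - b * A j) :
    False := by
  classical
  have h1gen : ∀ κ : Fin (p + 1) → Fin n, ∑ j, lam (κ j) j ≠ 0 := by
    intro κ h0
    have := h3gen 1 (fun j => {κ j}) le_rfl (by omega) (by simp) (by simpa using h0)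
    omega
  choose T T' hT hT' d ε hε hdT heT using fun j => aux_simdiag (A j) e (hdiag j) he (hcomm j)
  have hε1 : ∀ j i, ε j i ≠ 0 ↔ ε j i = 1 := by
    intro j i
    rcases hε j i with h | h <;> simp [h]
  have hε0 : ∀ j i, 1 - ε j i ≠ 0 ↔ ε j i = 0 := by
    intro j i
    rcases hε j i with h | h <;> simp [h]
  let E : Fin (p + 1) → Finset (Fin n) := fun j => Finset.univ.filter fun i => ε j i = 1
  let F : Fin (p + 1) → Finset (Fin n) := fun j => Finset.univ.filter fun i => ε j i = 0
  have hfT : ∀ j, (1 - e) * T j = T j * Matrix.diagonal (fun i => 1 - ε j i) := by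
    intro j
    rw [sub_mul, heT, one_mul]
    ext a b
    simp only [Matrix.sub_apply, Matrix.mul_diagonal]
    ring
  have hEcard : ∀ j, (E j).card = e.rank := by
    intro j
    rw [aux_rank_conj (T j) (T' j) e (hT j) (ε j) (heT j)]
    simp only [hε1, E]
  have hFcard : ∀ j, (F j).card = (1 - e).rank := by
    intro j
    rw [aux_rank_conj (T j) (T' j) (1 - e) (hT j) _ (hfT j)]
    simp only [hε0, F]
  have hl : 0 < e.rank := by
    rw [Nat.pos_iff_ne_zero]
    intro h0
    exact he0 (aux_rank_zero _ h0)
  have hm : 0 < (1 - e).rank := by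
    rw [Nat.pos_iff_ne_zero]
    intro h0
    exact he1 (sub_eq_zero.1 (aux_rank_zero _ h0)).symm
  have hdroot : ∀ j i, (A j).charpoly.eval (d j i) = 0 := by
    intro j i
    have hsim : (A j).charpoly = (Matrix.diagonal (d j)).charpoly := by
      have h1 : A j = T j * (Matrix.diagonal (d j) * T' j) := by
        rw [← mul_assoc, ← hdT, mul_assoc, hT, mul_one]
      rw [h1, Matrix.charpoly_mul_comm, mul_assoc, hT', mul_one]
    rw [hsim, Matrix.charpoly_diagonal, Polynomial.eval_prod]
    exact Finset.prod_eq_zero (Finset.mem_univ i) (by simp)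
  have hshT : ∀ j (z : ℂ), (A j - z • (1 : Matrix (Fin n) (Fin n) ℂ)) * T j =
      T j * Matrix.diagonal (fun i => d j i - z) := by
    intro j z
    rw [sub_mul, hdT, smul_mul_assoc, one_mul]
    ext a b
    simp only [Matrix.sub_apply, Matrix.mul_diagonal, Matrix.smul_apply, smul_eq_mul]
    ring
  have hrE : ∀ j (z : ℂ), ((A j - z • (1 : Matrix (Fin n) (Fin n) ℂ)) * e).rank =
      ((E j).filter fun i => d j i ≠ z).card := by
    intro j z
    rw [aux_rank_conj (T j) (T' j) _ (hT j) (fun i => (d j i - z) * ε j i)]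
    · congr 1
      ext i
      simp only [E, Finset.mem_filter, Finset.mem_univ, true_and, mul_ne_zero_iff, hε1,
        sub_ne_zero]
      tauto
    · rw [mul_assoc, heT, ← mul_assoc, hshT, mul_assoc, Matrix.diagonal_mul_diagonal]
  have hrF : ∀ j (z : ℂ), ((A j - z • (1 : Matrix (Fin n) (Fin n) ℂ)) * (1 - e)).rank =
      ((F j).filter fun i => d j i ≠ z).card := by
    intro j z
    rw [aux_rank_conj (T j) (T' j) _ (hT j) (fun i => (d j i - z) * (1 - ε j i))]
    · congr 1
      ext i
      simp only [F, Finset.mem_filter, Finset.mem_univ, true_and, mul_ne_zero_iff, hε0]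
      rw [sub_ne_zero]
      tauto
    · rw [mul_assoc, hfT, ← mul_assoc, hshT, mul_assoc, Matrix.diagonal_mul_diagonal]
  -- entrywise form of the maps
  have hcoordpi : ∀ j X i k, (T' j * piL e X * T j) i k =
      (ε j i * (1 - ε j k)) * (T' j * X * T j) i k := by
    intro j X i k
    have heT' : T' j * e = Matrix.diagonal (ε j) * T' j := by
      calc T' j * e = T' j * (e * (T j * T' j)) := by rw [hT, mul_one]
        _ = T' j * (e * T j) * T' j := by noncomm_ring
        _ = (T' j * T j) * Matrix.diagonal (ε j) * T' j := by rw [heT]; noncomm_ring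
        _ = _ := by rw [hT', one_mul]
    have h1 : T' j * piL e X * T j =
        Matrix.diagonal (ε j) * (T' j * X * T j) * Matrix.diagonal (fun i => 1 - ε j i) := by
      rw [piL_apply]
      calc T' j * (e * X * (1 - e)) * T j = (T' j * e) * X * ((1 - e) * T j) := by noncomm_ring
        _ = _ := by rw [heT', hfT]; simp only [mul_assoc]
    rw [h1, Matrix.mul_diagonal, Matrix.diagonal_mul]
    ring
  have hcoordad : ∀ j X i k, (T' j * adL (A j) X * T j) i k =
      (d j i - d j k) * (T' j * X * T j) i k := by
    intro j X i k
    have heT' : T' j * A j = Matrix.diagonal (d j) * T' j := by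
      calc T' j * A j = T' j * (A j * (T j * T' j)) := by rw [hT, mul_one]
        _ = T' j * (A j * T j) * T' j := by noncomm_ring
        _ = (T' j * T j) * Matrix.diagonal (d j) * T' j := by rw [hdT]; noncomm_ring
        _ = _ := by rw [hT', one_mul]
    have h1 : T' j * adL (A j) X * T j =
        Matrix.diagonal (d j) * (T' j * X * T j) - (T' j * X * T j) * Matrix.diagonal (d j) := by
      rw [adL_apply]
      calc T' j * (A j * X - X * A j) * T j = (T' j * A j) * X * T j - T' j * X * (A j * T j) := by
            noncomm_ring
        _ = _ := by rw [heT', hdT]; simp only [mul_assoc]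
    rw [h1, Matrix.sub_apply, Matrix.mul_diagonal, Matrix.diagonal_mul]
    ring
  have hfinpi : finrank ℂ (LinearMap.range (piL e)) = e.rank * (1 - e).rank := by
    rw [aux_rank_map (T 0) (T' 0) (hT 0) (hT' 0) (piL e)
      (fun x => ε 0 x.1 * (1 - ε 0 x.2)) (fun X i k => hcoordpi 0 X i k),
      ← hEcard 0, ← hFcard 0, ← Finset.card_product]
    congr 1
    ext x
    simp only [E, F, Finset.mem_filter, Finset.mem_univ, true_and, mul_ne_zero_iff, hε1,
      Finset.mem_product]
    rw [hε0]
  have hfinad : ∀ j, finrank ℂ (LinearMap.range (adL (A j) ∘ₗ piL e)) =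
      ((E j ×ˢ F j).filter fun x => d j x.1 ≠ d j x.2).card := by
    intro j
    rw [aux_rank_map (T j) (T' j) (hT j) (hT' j) (adL (A j) ∘ₗ piL e)
      (fun x => (d j x.1 - d j x.2) * (ε j x.1 * (1 - ε j x.2))) ?_]
    · congr 1
      ext x
      simp only [E, F, Finset.mem_filter, Finset.mem_univ, true_and, mul_ne_zero_iff, hε1,
        Finset.mem_product]
      rw [hε0, sub_ne_zero]
      tauto
    · intro X i k
      rw [LinearMap.comp_apply, hcoordad, hcoordpi]
      ring
  have hdim := aux_dim A e he hcomm hC0 H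
  simp only [hfinad] at hdim
  rw [hfinpi] at hdim
  obtain ⟨j1, j2, hj12, μ, ν, hμν, hμ⟩ := aux_comb (fun j : Fin p => E j.succ)
    (fun j => F j.succ) (fun j => d j.succ) hl hm (fun j => hEcard _) (fun j => hFcard _)
    (by
      intro κ
      have := aux_rkbound A hsum lam hchar h1gen (fun j => d j.succ (κ j))
        (fun j => hdroot _ _) e
      simpa only [hrE] using this)
    (by
      intro κ
      have := aux_rkbound A hsum lam hchar h1gen (fun j => d j.succ (κ j))
        (fun j => hdroot _ _) (1 - e)
      simpa only [hrF] using this) hdim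
  -- matrices annihilating the range of e
  have hzero : ∀ j (w : Fin n → ℂ) (B : Matrix (Fin n) (Fin n) ℂ),
      B * T j = T j * Matrix.diagonal w → (∀ i ∈ E j, w i = 0) → B * e = 0 := by
    intro j w B hB hw
    have h1 : B * e * T j = 0 := by
      rw [mul_assoc, heT, ← mul_assoc, hB, mul_assoc, Matrix.diagonal_mul_diagonal]
      have : (fun i => w i * ε j i) = 0 := by
        funext i
        rcases hε j i with h | h
        · simp [h]
        · simp [hw i (by simp [E, h])]
      rw [this]; simp
    calc B * e = B * e * T j * T' j := by rw [mul_assoc (B * e), hT, mul_one]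
      _ = 0 := by rw [h1, zero_mul]
  let R : Submodule ℂ (Fin n → ℂ) := LinearMap.range e.mulVecLin
  have hRmem : ∀ v ∈ R, e.mulVec v = v := by
    rintro _ ⟨v, rfl⟩
    simp only [Matrix.mulVecLin_apply, Matrix.mulVec_mulVec, he]
  have hRA : ∀ j, ∀ v ∈ R, (A j).mulVec v ∈ R := by
    intro j v hv
    refine ⟨(A j).mulVec v, ?_⟩
    rw [Matrix.mulVecLin_apply, Matrix.mulVec_mulVec, hcomm, ← Matrix.mulVec_mulVec, hRmem v hv]
  obtain ⟨i0, hi0⟩ : ∃ i, i ∈ E 0 := Finset.card_pos.1 (by rw [hEcard]; exact hl)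
  have hi0' : ε 0 i0 = 1 := by simpa [E] using hi0
  let x : Fin n → ℂ := fun a => T 0 a i0
  have hx0 : x ≠ 0 := by
    intro h0
    have h1 := congrFun (congrFun (hT' 0) i0) i0
    rw [Matrix.mul_apply] at h1
    have h2 : ∀ a, T 0 a i0 = 0 := fun a => congrFun h0 a
    simp [h2] at h1
  have hxR : x ∈ R := by
    refine ⟨x, ?_⟩
    funext a
    have := congrFun (congrFun (heT 0) a) i0
    rw [Matrix.mul_diagonal, hi0', mul_one] at this
    exact this
  have hxθ : (A 0).mulVec x = d 0 i0 • x := by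
    funext a
    have := congrFun (congrFun (hdT 0) a) i0
    rw [Matrix.mul_diagonal, mul_comm] at this
    exact this
  have hinv := aux_inv_sub A hsum R hRA x hxR (d 0 i0) hxθ j1 j2 hj12 μ ν
    (by
      intro j a b v hv
      have h1 := hzero j.succ _ _ (hshT j.succ (μ j))
        (fun i hi => sub_eq_zero.2 (hμ j a b i hi))
      have h2 := congrArg (fun M => M.mulVec v) h1
      simp only [← Matrix.mulVec_mulVec, hRmem v hv, Matrix.zero_mulVec, Matrix.sub_mulVec,
        Matrix.smul_mulVec, Matrix.one_mulVec] at h2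
      exact sub_eq_zero.1 h2)
    (by
      intro j v hv
      have h1 := hzero j.succ (fun i => (d j.succ i - μ j) * (d j.succ i - ν j))
        ((A j.succ - μ j • (1 : Matrix (Fin n) (Fin n) ℂ)) *
          (A j.succ - ν j • (1 : Matrix (Fin n) (Fin n) ℂ)))
        (by rw [mul_assoc, hshT, ← mul_assoc, hshT, mul_assoc, Matrix.diagonal_mul_diagonal])
        (fun i hi => by
          rcases hμν j i hi with h | h
          · rw [h]; ring
          · rw [h]; ring)
      have h2 := congrArg (fun M => M.mulVec v) h1
      simp only [← Matrix.mulVec_mulVec, hRmem v hv, Matrix.zero_mulVec, Matrix.sub_mulVec,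
        Matrix.smul_mulVec, Matrix.one_mulVec, Matrix.mulVec_sub, Matrix.mulVec_smul] at h2
      rw [← sub_eq_zero, ← h2, add_smul, mul_smul]
      simp only [smul_sub]
      module)
  obtain ⟨Φ, hΦ1, hΦ2⟩ := aux_relation A hsum lam hchar _ hinv
  set W := Submodule.span ℂ {x, (A j1.succ).mulVec x} with hWdef
  have hW1 : 1 ≤ finrank ℂ W := by
    rw [Nat.one_le_iff_ne_zero, Ne, Submodule.finrank_eq_zero]
    intro h0
    have : x ∈ W := Submodule.subset_span (by simp)
    rw [h0] at this
    exact hx0 (by simpa using this)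
  have hW2 : finrank ℂ W ≤ 2 := by
    have h1 := finrank_span_finset_le_card (R := ℂ) ({x, (A j1.succ).mulVec x} : Finset (Fin n → ℂ))
    have h2 := Finset.card_le_two (a := x) (b := (A j1.succ).mulVec x)
    simp only [Finset.coe_insert, Finset.coe_singleton] at h1
    exact h1.trans h2
  have hWR : W ≤ R := by
    rw [hWdef, Submodule.span_le]
    intro v hv
    simp only [Set.mem_insert_iff, Set.mem_singleton_iff] at hv
    rcases hv with rfl | rfl
    · exact hxR
    · exact hRA _ _ hxR
  have hW3 : finrank ℂ W ≤ e.rank := Submodule.finrank_mono hWR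
  have hsumcard : e.rank + (1 - e).rank ≤ n := by
    rw [← hEcard 0, ← hFcard 0, ← Finset.card_union_of_disjoint]
    · exact (Finset.card_le_univ _).trans_eq (Fintype.card_fin n)
    · rw [Finset.disjoint_filter]
      intro i _ a b
      rw [a] at b
      exact one_ne_zero b
  have := h3gen _ Φ hW1 (by omega) hΦ1 hΦ2
  omega


theorem aux_distinct {n : ℕ} (B : Matrix (Fin n) (Fin n) ℂ) (hB : IsDiagble B) (lam : Fin n → ℂ)
    (hchar : B.charpoly = ∏ k, (Polynomial.X - Polynomial.C (lam k)))
    (hinj : Function.Injective lam) :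
    ∃ S S' : Matrix (Fin n) (Fin n) ℂ, S * S' = 1 ∧ S' * S = 1 ∧
      ∀ X, X * B = B * X → ∃ x : Fin n → ℂ, X * S = S * Matrix.diagonal x := by
  obtain ⟨S, hS, d, hBS⟩ := hB
  have hSu := (Matrix.isUnit_iff_isUnit_det _).1 hS
  have h1 := Matrix.mul_nonsing_inv _ hSu
  have h2 := Matrix.nonsing_inv_mul _ hSu
  have hd : Function.Injective d := by
    have e1 : B.charpoly = ∏ k, (Polynomial.X - Polynomial.C (d k)) := by
      rw [hBS, mul_assoc, Matrix.charpoly_mul_comm, mul_assoc, h2, mul_one,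
        Matrix.charpoly_diagonal]
    have e2 : ∀ f : Fin n → ℂ, (∏ k, (Polynomial.X - Polynomial.C (f k))).roots =
        Finset.univ.val.map f := by
      intro f
      rw [Polynomial.roots_prod _ _ (Finset.prod_ne_zero_iff.2 fun k _ => Polynomial.X_sub_C_ne_zero _)]
      simp
    have e3 : Finset.univ.val.map d = Finset.univ.val.map lam := by
      rw [← e2, ← e2, ← e1, hchar]
    have e4 : (Finset.univ.val.map d).Nodup := by
      rw [e3]; exact (Multiset.nodup_map_iff_of_injective hinj).2 Finset.univ.nodup
    intro a b hab
    exact Multiset.inj_on_of_nodup_map e4 a (Finset.mem_univ a) b (Finset.mem_univ b) hab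
  refine ⟨S, S⁻¹, h1, h2, ?_⟩
  intro X hX
  have h3 : (S⁻¹ * X * S) * Matrix.diagonal d = Matrix.diagonal d * (S⁻¹ * X * S) := by
    have e1 : S⁻¹ * (X * B) * S = (S⁻¹ * X * S) * Matrix.diagonal d := by
      calc S⁻¹ * (X * B) * S = S⁻¹ * X * S * Matrix.diagonal d * (S⁻¹ * S) := by
            rw [hBS]; simp only [mul_assoc]
        _ = _ := by rw [h2, mul_one]
    have e2 : S⁻¹ * (B * X) * S = Matrix.diagonal d * (S⁻¹ * X * S) := by
      calc S⁻¹ * (B * X) * S = (S⁻¹ * S) * Matrix.diagonal d * (S⁻¹ * X * S) := by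
            rw [hBS]; simp only [mul_assoc]
        _ = _ := by rw [h2, one_mul]
    rw [← e1, ← e2, hX]
  refine ⟨fun i => (S⁻¹ * X * S) i i, ?_⟩
  have h4 : S⁻¹ * X * S = Matrix.diagonal fun i => (S⁻¹ * X * S) i i := by
    ext i k
    by_cases hik : i = k
    · subst hik; simp
    · rw [Matrix.diagonal_apply_ne _ hik]
      have := congrFun (congrFun h3 i) k
      rw [Matrix.mul_diagonal, Matrix.diagonal_mul] at this
      have h5 : (S⁻¹ * X * S) i k * (d k - d i) = 0 := by rw [mul_sub, this]; ring
      rcases mul_eq_zero.1 h5 with h | h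
      · exact h
      · exact absurd (hd (sub_eq_zero.1 h)).symm hik
  rw [← h4]
  calc X * S = (S * S⁻¹) * X * S := by rw [h1, one_mul]
    _ = _ := by simp only [mul_assoc]

theorem aux_idem {n q : ℕ} (A : Fin q → Matrix (Fin n) (Fin n) ℂ)
    (S S' Z : Matrix (Fin n) (Fin n) ℂ) (h1 : S * S' = 1) (h2 : S' * S = 1)
    (z : Fin n → ℂ) (hz : Z * S = S * Matrix.diagonal z) (hZ : Z ∈ centT A)
    (hns : ¬ ∃ c : ℂ, Z = c • (1 : Matrix (Fin n) (Fin n) ℂ)) (hn : 0 < n) :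
    ∃ e, e * e = e ∧ e ≠ 0 ∧ e ≠ 1 ∧ ∀ j, e * A j = A j * e := by
  classical
  let i0 : Fin n := ⟨0, hn⟩
  let w : Fin n → ℂ := fun i => if z i = z i0 then 1 else 0
  have hZ' : Z = S * Matrix.diagonal z * S' := by
    rw [← hz, mul_assoc, h1, mul_one]
  have hback : ∀ D, S' * (S * D * S') * S = D := by
    intro D
    calc S' * (S * D * S') * S = (S' * S) * D * (S' * S) := by simp only [mul_assoc]
      _ = D := by rw [h2]; simp
  refine ⟨S * Matrix.diagonal w * S', ?_, ?_, ?_, ?_⟩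
  · calc S * Matrix.diagonal w * S' * (S * Matrix.diagonal w * S')
        = S * Matrix.diagonal w * (S' * S) * Matrix.diagonal w * S' := by simp only [mul_assoc]
      _ = S * (Matrix.diagonal w * Matrix.diagonal w) * S' := by rw [h2]; simp only [mul_assoc, one_mul]
      _ = _ := by
        rw [Matrix.diagonal_mul_diagonal]
        congr 3
        funext i
        simp only [w]; split_ifs <;> simp
  · intro h0
    have h3 := hback (Matrix.diagonal w)
    rw [h0] at h3
    have := congrFun (congrFun h3 i0) i0
    simp [w] at this
  · intro h0
    apply hns
    have h3 := hback (Matrix.diagonal w)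
    rw [h0, mul_one, h2] at h3
    refine ⟨z i0, ?_⟩
    have hall : ∀ i, z i = z i0 := by
      intro i
      have := congrFun (congrFun h3 i) i
      by_contra hne
      simp [w, hne] at this
    have : z = fun _ => z i0 := funext hall
    rw [hZ', this, ← Matrix.smul_one_eq_diagonal]
    simp [h1]
  · intro j
    have hB : Matrix.diagonal z * (S' * A j * S) = (S' * A j * S) * Matrix.diagonal z := by
      have hZj := hZ j
      have e1 : S' * (Z * A j) * S = Matrix.diagonal z * (S' * A j * S) := by
        calc S' * (Z * A j) * S = (S' * S) * Matrix.diagonal z * (S' * A j * S) := by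
              rw [hZ']; simp only [mul_assoc]
          _ = _ := by rw [h2, one_mul]
      have e2 : S' * (A j * Z) * S = (S' * A j * S) * Matrix.diagonal z := by
        calc S' * (A j * Z) * S = (S' * A j * S) * Matrix.diagonal z * (S' * S) := by
              rw [hZ']; simp only [mul_assoc]
          _ = _ := by rw [h2, mul_one]
      rw [← e1, ← e2, hZj]
    have hW : Matrix.diagonal w * (S' * A j * S) = (S' * A j * S) * Matrix.diagonal w := by
      ext i k
      have := congrFun (congrFun hB i) k
      rw [Matrix.mul_diagonal, Matrix.diagonal_mul] at this ⊢
      by_cases hik : z i = z k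
      · simp only [w, hik]; ring
      · have h5 : (S' * A j * S) i k * (z i - z k) = 0 := by rw [mul_sub, ← this]; ring
        rcases mul_eq_zero.1 h5 with h | h
        · rw [h]; ring
        · exact absurd (sub_eq_zero.1 h) hik
    calc S * Matrix.diagonal w * S' * A j = S * Matrix.diagonal w * S' * A j * (S * S') := by
          rw [h1, mul_one]
      _ = S * (Matrix.diagonal w * (S' * A j * S)) * S' := by simp only [mul_assoc]
      _ = (S * S') * A j * S * Matrix.diagonal w * S' := by rw [hW]; simp only [mul_assoc]
      _ = _ := by rw [h1]; simp only [mul_assoc, one_mul]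

theorem aux_sameClass_trans {n : ℕ} {A B C : Matrix (Fin n) (Fin n) ℂ} (h1 : SameClass A B)
    (h2 : SameClass B C) : SameClass A C := by
  obtain ⟨S, hS, rfl⟩ := h1
  obtain ⟨T, hT, rfl⟩ := h2
  refine ⟨S * T, hS.mul hT, ?_⟩
  rw [Matrix.mul_inv_rev]
  simp only [mul_assoc]

theorem aux_sameClass_charpoly {n : ℕ} {A B : Matrix (Fin n) (Fin n) ℂ} (h1 : SameClass A B) :
    A.charpoly = B.charpoly := by
  obtain ⟨S, hS, rfl⟩ := h1
  have hSu := (Matrix.isUnit_iff_isUnit_det _).1 hS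
  rw [mul_assoc, Matrix.charpoly_mul_comm, mul_assoc, Matrix.nonsing_inv_mul _ hSu, mul_one]

theorem aux_main {n p : ℕ} (hn : 2 ≤ n) (lam : Fin n → Fin (p + 1) → ℂ)
    (hdist : Function.Injective fun k => lam k 0)
    (h3gen : ∀ (N : ℕ) (Φ : Fin (p + 1) → Finset (Fin n)),
      1 ≤ N → N ≤ n - 1 → (∀ j, (Φ j).card = N) →
      (∑ j, ∑ k ∈ Φ j, lam k j) = 0 → 3 ≤ min N (n - N)) (r : ℕ) :
    ∀ (A : Fin (p + 1) → Matrix (Fin n) (Fin n) ℂ)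
    (_ : ∀ j, IsDiagble (A j)) (_ : ∑ j, A j = 0)
    (_ : ∀ j, (A j).charpoly = ∏ k, (Polynomial.X - Polynomial.C (lam k j)))
    (_ : finrank ℂ (centT A) = r),
    A ∈ closure {A' : Fin (p + 1) → Matrix (Fin n) (Fin n) ℂ |
      (∀ j, SameClass (A' j) (A j)) ∧ ∑ j, A' j = 0 ∧ TrivialCentralizer A'} := by
  induction r using Nat.strong_induction_on with | _ r ih
  intro A hdiag hsum hchar hr
  by_cases htriv : TrivialCentralizer A
  · exact subset_closure ⟨fun j => ⟨1, isUnit_one, by simp⟩, hsum, htriv⟩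
  obtain ⟨S, S', h1, h2, hX⟩ := aux_distinct (A 0) (hdiag 0) _ (hchar 0) hdist
  have hcom : ∀ X Z, X * A 0 = A 0 * X → Z * A 0 = A 0 * Z → X * Z = Z * X := by
    intro X Z hXA hZA
    obtain ⟨x, hx⟩ := hX X hXA
    obtain ⟨z, hz⟩ := hX Z hZA
    have e1 : X * Z * S = Z * X * S := by
      rw [mul_assoc, hz, ← mul_assoc, hx, mul_assoc Z, hx, ← mul_assoc, hz, mul_assoc, mul_assoc,
        Matrix.diagonal_mul_diagonal, Matrix.diagonal_mul_diagonal]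
      simp only [mul_comm]
    calc X * Z = X * Z * S * S' := by rw [mul_assoc (X * Z), h1, mul_one]
      _ = Z * X := by rw [e1, mul_assoc (Z * X), h1, mul_one]
  unfold TrivialCentralizer at htriv
  push Not at htriv
  obtain ⟨Z, hZ, hZns⟩ := htriv
  obtain ⟨z, hz⟩ := hX Z (hZ 0)
  obtain ⟨e, he, he0, he1, hcomm⟩ := aux_idem A S S' Z h1 h2 z hz hZ
    (by rintro ⟨c, hc⟩; exact hZns c hc) (by omega)
  have hC0 : ∀ X, X * A 0 = A 0 * X → e * X = X * e := fun X h => hcom e X (hcomm 0) h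
  have hex : ∃ X : Fin (p + 1) → Matrix (Fin n) (Fin n) ℂ, (∀ j, e * X j = X j) ∧
      (∀ j, X j * e = 0) ∧ ∑ j, (A j * X j - X j * A j) = 0 ∧
      ¬ ∃ b, e * b = b ∧ b * e = 0 ∧ ∀ j, A j * X j - X j * A j = A j * b - b * A j := by
    by_contra hcon
    push Not at hcon
    refine aux_nonsplit hn A hdiag hsum lam hchar h3gen e he he0 he1 hcomm hC0 ?_
    intro X a b c
    by_contra hb
    push Not at hb
    obtain ⟨b', h1, h2, h3⟩ := hcon X a b c
    obtain ⟨j, hj⟩ := hb b' h1 h2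
    exact hj (h3 j)
  obtain ⟨X, hX1, hX2, hX3, hX4⟩ := hex
  let f : ℂ → Fin (p + 1) → Matrix (Fin n) (Fin n) ℂ :=
    fun t j => A j + t • (A j * X j - X j * A j)
  have hft : ∀ t : ℂ, t ≠ 0 → f t ∈ closure {A' : Fin (p + 1) → Matrix (Fin n) (Fin n) ℂ |
      (∀ j, SameClass (A' j) (A j)) ∧ ∑ j, A' j = 0 ∧ TrivialCentralizer A'} := by
    intro t ht
    have hsc : ∀ j, SameClass (f t j) (A j) := by
      intro j
      have := aux_sameClass (A j) (t • X j) e (hcomm j) (by rw [mul_smul_comm, hX1])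
        (by rw [smul_mul_assoc, hX2, smul_zero])
      rw [mul_smul_comm, smul_mul_assoc, ← smul_sub] at this
      exact this
    have hlt : finrank ℂ (centT (f t)) < r := by
      rw [← hr]
      refine aux_cent_lt A (fun j => t • (A j * X j - X j * A j)) e he hcomm
        (fun X hX => hC0 X (hX 0)) ?_ ?_ ?_
      · intro j
        have := ((mem_range_piL e _ he).1 (adL_mem e (A j) (X j) he (hcomm j)
          ((mem_range_piL e _ he).2 ⟨hX1 j, hX2 j⟩))).1
        rw [adL_apply] at this
        rw [mul_smul_comm, this]
      · intro j
        have := ((mem_range_piL e _ he).1 (adL_mem e (A j) (X j) he (hcomm j)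
          ((mem_range_piL e _ he).2 ⟨hX1 j, hX2 j⟩))).2
        rw [adL_apply] at this
        rw [smul_mul_assoc, this, smul_zero]
      · rintro ⟨b, hb1, hb2, hb3⟩
        apply hX4
        refine ⟨t⁻¹ • b, by rw [mul_smul_comm, hb1], by rw [smul_mul_assoc, hb2, smul_zero], ?_⟩
        intro j
        rw [mul_smul_comm, smul_mul_assoc, ← smul_sub, ← hb3 j, smul_smul, inv_mul_cancel₀ ht,
          one_smul]
    have hthis := ih _ hlt (f t)
      (by
        intro j
        obtain ⟨U, hU, d, hd⟩ := hdiag j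
        obtain ⟨V, hV, hVd⟩ := aux_sameClass_trans (hsc j) ⟨U, hU, hd⟩
        exact ⟨V, hV, d, hVd⟩)
      (by
        simp only [f]
        rw [Finset.sum_add_distrib, hsum, ← Finset.smul_sum, hX3, smul_zero, add_zero])
      (fun j => (aux_sameClass_charpoly (hsc j)).trans (hchar j)) rfl
    refine closure_mono ?_ hthis
    rintro B ⟨hB1, hB2, hB3⟩
    exact ⟨fun j => aux_sameClass_trans (hB1 j) (hsc j), hB2, hB3⟩
  have hcont : Continuous f := by
    refine continuous_pi fun j => ?_
    exact continuous_const.add (continuous_id.smul continuous_const)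
  have h0 : f 0 = A := by funext j; simp [f]
  have htend : Filter.Tendsto f (nhdsWithin 0 {0}ᶜ) (nhds A) := by
    have := hcont.tendsto 0
    rw [h0] at this
    exact this.mono_left nhdsWithin_le_nhds
  have hmem := mem_closure_of_tendsto htend
    (Filter.eventually_of_mem self_mem_nhdsWithin fun t ht => hft t ht)
  rwa [closure_closure] at hmem


/-- A tuple of diagonalizable matrices with zero sum, `A_1` having distinct eigenvalues
and 3-generic eigenvalues, lies in the closure of the set of tuples from the same
conjugacy classes, with zero sum and trivial centralizer. -/
theorem stmt11 (n p : ℕ) (hn : 2 ≤ n) (hp : 1 ≤ p)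
    (A : Fin (p + 1) → Matrix (Fin n) (Fin n) ℂ)
    (hdiag : ∀ j, IsDiagble (A j))
    (hsum : ∑ j, A j = 0)
    (lam : Fin n → Fin (p + 1) → ℂ)
    (hchar : ∀ j, (A j).charpoly = ∏ k, (Polynomial.X - Polynomial.C (lam k j)))
    (hdist : Function.Injective fun k => lam k 0)
    (h3gen : ∀ (N : ℕ) (Φ : Fin (p + 1) → Finset (Fin n)),
      1 ≤ N → N ≤ n - 1 → (∀ j, (Φ j).card = N) →
      (∑ j, ∑ k ∈ Φ j, lam k j) = 0 → 3 ≤ min N (n - N)) :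
    A ∈ closure {A' : Fin (p + 1) → Matrix (Fin n) (Fin n) ℂ |
      (∀ j, SameClass (A' j) (A j)) ∧ ∑ j, A' j = 0 ∧ TrivialCentralizer A'} := by
  exact aux_main hn lam hdist h3gen _ A hdiag hsum hchar rfl
end

section
/- Let l, m ≥ 1 and p ≥ 1, and for j = 1,…,p+1 let P_j ∈ M_l(ℂ) and R_j ∈ M_m(ℂ) with P_1 + ⋯ + P_{p+1} = 0 and R_1 + ⋯ + R_{p+1} = 0. Assume the tuple (P_1,…,P_{p+1}) and the tuple (R_1,…,R_{p+1}) each have trivial centralizer, and that P_1 and R_1 each have distinct eigenvalues and have no eigenvalue in common. For each j set 𝒳_j := {P_j X − X R_j : X ∈ M_{l×m}(ℂ)} and s_j := dim_ℂ 𝒳_j. Let V := {(Z_1,…,Z_{p+1}) : Z_j ∈ 𝒳_j for all j and Z_1 + ⋯ + Z_{p+1} = 0} and W := {(P_1X − XR_1, …, P_{p+1}X − XR_{p+1}) : X ∈ M_{l×m}(ℂ)}. Then W is a subspace of V and dim_ℂ V − dim_ℂ W = s_1 + ⋯ + s_{p+1} − 2lm. -/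
open Polynomial BigOperators

/-- The subspace `V` of tuples `(Z_1,…,Z_{p+1})` with `Z_j` in the image of the `j`-th
Sylvester map and zero sum. -/
noncomputable def sumZeroV {l m p : ℕ}
    (P : Fin (p + 1) → Matrix (Fin l) (Fin l) ℂ)
    (R : Fin (p + 1) → Matrix (Fin m) (Fin m) ℂ) :
    Submodule ℂ (Fin (p + 1) → Matrix (Fin l) (Fin m) ℂ) where
  carrier := {Z | (∀ j, Z j ∈ LinearMap.range (sylv (P j) (R j))) ∧ ∑ j, Z j = 0}
  add_mem' := by
    rintro a b ⟨ha1, ha2⟩ ⟨hb1, hb2⟩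
    refine ⟨fun j => add_mem (ha1 j) (hb1 j), ?_⟩
    simp only [Pi.add_apply, Finset.sum_add_distrib, ha2, hb2, add_zero]
  zero_mem' := ⟨fun j => zero_mem _, by simp⟩
  smul_mem' := by
    rintro c a ⟨ha1, ha2⟩
    refine ⟨fun j => Submodule.smul_mem _ c (ha1 j), ?_⟩
    simp only [Pi.smul_apply, ← Finset.smul_sum, ha2, smul_zero]

/-- The map `X ↦ (P_j X - X R_j)_j`. -/
noncomputable def diagSylv {l m p : ℕ}
    (P : Fin (p + 1) → Matrix (Fin l) (Fin l) ℂ)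
    (R : Fin (p + 1) → Matrix (Fin m) (Fin m) ℂ) :
    Matrix (Fin l) (Fin m) ℂ →ₗ[ℂ] (Fin (p + 1) → Matrix (Fin l) (Fin m) ℂ) :=
  LinearMap.pi fun j => sylv (P j) (R j)


theorem sylv_aeval {l m : ℕ} (A : Matrix (Fin l) (Fin l) ℂ) (B : Matrix (Fin m) (Fin m) ℂ)
    (Z : Matrix (Fin l) (Fin m) ℂ) (h : A * Z = Z * B) (q : Polynomial ℂ) :
    Polynomial.aeval A q * Z = Z * Polynomial.aeval B q := by
  induction q using Polynomial.induction_on' with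
  | add a b ha hb => rw [map_add, map_add, Matrix.add_mul, Matrix.mul_add, ha, hb]
  | monomial n c =>
    have hn : A ^ n * Z = Z * B ^ n := by
      induction n with
      | zero => simp
      | succ k ih => rw [pow_succ, pow_succ, Matrix.mul_assoc, h, ← Matrix.mul_assoc, ih,
          Matrix.mul_assoc]
    rw [Polynomial.aeval_monomial, Polynomial.aeval_monomial, Algebra.algebraMap_eq_smul_one,
      Algebra.algebraMap_eq_smul_one]
    simp [hn]

theorem sylv_inj {l m : ℕ} (A : Matrix (Fin l) (Fin l) ℂ) (B : Matrix (Fin m) (Fin m) ℂ)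
    (hA : HasDistinctEigenvalues A)
    (hdisj : ∀ μ : ℂ, ¬((A - μ • (1 : Matrix (Fin l) (Fin l) ℂ)).det = 0 ∧
        (B - μ • (1 : Matrix (Fin m) (Fin m) ℂ)).det = 0)) :
    Function.Injective (sylv A B) := by
  rw [injective_iff_map_eq_zero]
  intro Z hZ
  have h : A * Z = Z * B := sub_eq_zero.mp hZ
  obtain ⟨μ, -, hμ⟩ := hA
  have hroot : ∀ k, (A - μ k • (1 : Matrix (Fin l) (Fin l) ℂ)).det = 0 := by
    intro k
    have h1 : A.charpoly.eval (μ k) = 0 := by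
      rw [hμ, Polynomial.eval_prod]
      exact Finset.prod_eq_zero (Finset.mem_univ k) (by simp)
    rw [Matrix.eval_charpoly] at h1
    rw [← neg_sub, Matrix.det_neg, ← Algebra.algebraMap_eq_smul_one]
    have : algebraMap ℂ (Matrix (Fin l) (Fin l) ℂ) (μ k) = Matrix.scalar (Fin l) (μ k) := rfl
    rw [this, h1, mul_zero]
  have hunit : ∀ s : Finset (Fin l), IsUnit (Polynomial.aeval B
      (∏ k ∈ s, (Polynomial.X - Polynomial.C (μ k)))) := by
    intro s
    induction s using Finset.induction_on with
    | empty => simp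
    | insert a s ha ih =>
      rw [Finset.prod_insert ha, map_mul]
      refine IsUnit.mul ?_ ih
      rw [Matrix.isUnit_iff_isUnit_det, isUnit_iff_ne_zero]
      intro h0
      refine hdisj (μ a) ⟨hroot a, ?_⟩
      simpa [Algebra.algebraMap_eq_smul_one] using h0
  have h2 := sylv_aeval A B Z h A.charpoly
  rw [Matrix.aeval_self_charpoly, Matrix.zero_mul, hμ] at h2
  obtain ⟨u, hu⟩ := hunit Finset.univ
  rw [← hu] at h2
  have h3 : Z * (u : Matrix (Fin m) (Fin m) ℂ) * (↑u⁻¹ : Matrix (Fin m) (Fin m) ℂ) = 0 := by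
    rw [← h2, Matrix.zero_mul]
  rwa [Matrix.mul_assoc, Units.mul_inv, Matrix.mul_one] at h3

/-- `dim V - dim W = s_1 + ⋯ + s_{p+1} - 2lm` (the dimension of `Ext¹` of the two
representations). -/
theorem stmt13 (l m p : ℕ) (hl : 1 ≤ l) (hm : 1 ≤ m) (hp : 1 ≤ p)
    (P : Fin (p + 1) → Matrix (Fin l) (Fin l) ℂ)
    (R : Fin (p + 1) → Matrix (Fin m) (Fin m) ℂ)
    (hPsum : ∑ j, P j = 0) (hRsum : ∑ j, R j = 0)
    (hPcent : TrivialCentralizer P) (hRcent : TrivialCentralizer R)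
    (hPdist : HasDistinctEigenvalues (P 0)) (hRdist : HasDistinctEigenvalues (R 0))
    (hdisj : ∀ μ : ℂ, ¬((P 0 - μ • (1 : Matrix (Fin l) (Fin l) ℂ)).det = 0 ∧
        (R 0 - μ • (1 : Matrix (Fin m) (Fin m) ℂ)).det = 0)) :
    LinearMap.range (diagSylv P R) ≤ sumZeroV P R ∧
      (Module.finrank ℂ (sumZeroV P R) : ℤ) -
          (Module.finrank ℂ (LinearMap.range (diagSylv P R)) : ℤ) =
        ∑ j, (sDim (P j) (R j) : ℤ) - 2 * l * m := by
  have hinj := sylv_inj (P 0) (R 0) hPdist hdisj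
  have hsurj : Function.Surjective (sylv (P 0) (R 0)) := LinearMap.injective_iff_surjective.mp hinj
  constructor
  · rintro _ ⟨Z, rfl⟩
    refine ⟨fun j => ⟨Z, rfl⟩, ?_⟩
    change ∑ j, (P j * Z - Z * R j) = 0
    rw [Finset.sum_sub_distrib, ← Matrix.sum_mul, ← Matrix.mul_sum, hPsum, hRsum]
    simp
  have hW : Module.finrank ℂ (LinearMap.range (diagSylv P R)) = l * m := by
    rw [LinearMap.finrank_range_of_inj, Module.finrank_matrix]
    · simp
    · intro a b hab
      exact hinj (congrFun hab 0)
  let S : (∀ j, LinearMap.range (sylv (P j) (R j))) →ₗ[ℂ] Matrix (Fin l) (Fin m) ℂ :=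
    ∑ j, (LinearMap.range (sylv (P j) (R j))).subtype ∘ₗ LinearMap.proj j
  have hS : ∀ f, S f = ∑ j, (f j : Matrix (Fin l) (Fin m) ℂ) := by
    intro f; simp [S]
  have hSs : LinearMap.range S = ⊤ := by
    rw [LinearMap.range_eq_top]
    intro Z
    refine ⟨Pi.single 0 ⟨Z, hsurj Z⟩, ?_⟩
    rw [hS, Finset.sum_eq_single 0]
    · simp
    · intro b _ hb
      simp [Pi.single_eq_of_ne hb]
    · simp
  have hrn := LinearMap.finrank_range_add_finrank_ker S
  rw [hSs, finrank_top, Module.finrank_matrix, Module.finrank_pi_fintype] at hrn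
  let e : LinearMap.ker S ≃ₗ[ℂ] sumZeroV P R :=
    { toFun := fun f => ⟨fun j => (f.1 j : Matrix (Fin l) (Fin m) ℂ),
        fun j => (f.1 j).2, by rw [← hS]; exact f.2⟩
      invFun := fun g => ⟨fun j => ⟨g.1 j, g.2.1 j⟩, by
        rw [LinearMap.mem_ker, hS]; exact g.2.2⟩
      map_add' := fun _ _ => rfl
      map_smul' := fun _ _ => rfl
      left_inv := fun _ => rfl
      right_inv := fun _ => rfl }
  rw [e.finrank_eq] at hrn
  rw [hW]
  simp only [Fintype.card_fin, Module.finrank_self, mul_one] at hrn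
  have hrn' : ((l * m + Module.finrank ℂ (sumZeroV P R) : ℕ) : ℤ) =
      ∑ j, (sDim (P j) (R j) : ℤ) := by
    rw [hrn]; push_cast; rfl
  push_cast at hrn' ⊢
  linarith
end

section
/- Let P ∈ M_l(ℂ) and R ∈ M_m(ℂ) be diagonalizable matrices. Then the image of the Sylvester map X ↦ PX − XR on M_{l×m}(ℂ) has dimension l·m − Σ_{λ∈ℂ} m_P(λ)·m_R(λ), where m_P(λ) := dim_ℂ ker(P − λI) and m_R(λ) := dim_ℂ ker(R − λI) (the sum has finitely many nonzero terms, over the common eigenvalues of P and R). -/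
open Polynomial BigOperators

lemma multOf_diag {n : ℕ} (S : Matrix (Fin n) (Fin n) ℂ) (hS : IsUnit S) (d : Fin n → ℂ) (μ : ℂ) :
    multOf (S * Matrix.diagonal d * S⁻¹) μ = (Finset.univ.filter (fun i => d i = μ)).card := by
  have hdet : IsUnit S.det := (Matrix.isUnit_iff_isUnit_det S).1 hS
  have h1 : S * Matrix.diagonal d * S⁻¹ - μ • (1 : Matrix (Fin n) (Fin n) ℂ)
      = S * Matrix.diagonal (fun i => d i - μ) * S⁻¹ := by
    have : Matrix.diagonal (fun i => d i - μ) = Matrix.diagonal d - μ • (1 : Matrix (Fin n) (Fin n) ℂ) := by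
      rw [Matrix.smul_one_eq_diagonal, Matrix.diagonal_sub]
    rw [this, Matrix.mul_sub, Matrix.sub_mul, Matrix.mul_smul, Matrix.smul_mul, Matrix.mul_one,
      Matrix.mul_nonsing_inv _ hdet]
  have hr : (S * Matrix.diagonal (fun i => d i - μ) * S⁻¹).rank
      = Fintype.card {i // d i - μ ≠ 0} := by
    rw [Matrix.rank_mul_eq_left_of_isUnit_det _ _ (Matrix.isUnit_nonsing_inv_det S hdet),
      Matrix.rank_mul_eq_right_of_isUnit_det _ _ hdet, Matrix.rank_diagonal]
  have hk := LinearMap.finrank_range_add_finrank_ker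
    (S * Matrix.diagonal (fun i => d i - μ) * S⁻¹).mulVecLin
  unfold multOf
  rw [h1]
  unfold Matrix.rank at hr
  rw [hr, Fintype.card_subtype, Module.finrank_fin_fun] at hk
  have hc := Finset.card_filter_add_card_filter_not (s := (Finset.univ : Finset (Fin n)))
    (fun i => d i = μ)
  simp only [sub_ne_zero, Finset.card_univ, Fintype.card_fin, ne_eq] at hk hc
  omega

lemma sDim_diag {l m : ℕ} (S : Matrix (Fin l) (Fin l) ℂ) (hS : IsUnit S) (d : Fin l → ℂ)
    (T : Matrix (Fin m) (Fin m) ℂ) (hT : IsUnit T) (e : Fin m → ℂ) :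
    sDim (S * Matrix.diagonal d * S⁻¹) (T * Matrix.diagonal e * T⁻¹)
      = (Finset.univ.filter (fun p : Fin l × Fin m => d p.1 ≠ e p.2)).card := by
  have hS' : IsUnit S.det := (Matrix.isUnit_iff_isUnit_det S).1 hS
  have hT' : IsUnit T.det := (Matrix.isUnit_iff_isUnit_det T).1 hT
  let Φ : (Fin l × Fin m → ℂ) ≃ₗ[ℂ] Matrix (Fin l) (Fin m) ℂ :=
    { toFun := fun f => S * Matrix.of (fun i j => f (i, j)) * T⁻¹
      invFun := fun Z p => (S⁻¹ * Z * T) p.1 p.2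
      map_add' := by
        intro f g
        rw [← Matrix.add_mul, ← Matrix.mul_add]; rfl
      map_smul' := by
        intro c f
        rw [RingHom.id_apply, ← Matrix.smul_mul, ← Matrix.mul_smul]; rfl
      left_inv := by
        intro f
        funext p
        simp only [Matrix.mul_assoc]
        rw [Matrix.nonsing_inv_mul _ hT', Matrix.mul_one, ← Matrix.mul_assoc,
          Matrix.nonsing_inv_mul _ hS', Matrix.one_mul]
        rfl
      right_inv := by
        intro Z
        change S * (S⁻¹ * Z * T) * T⁻¹ = Z
        simp only [Matrix.mul_assoc]
        rw [Matrix.mul_nonsing_inv _ hT', Matrix.mul_one, ← Matrix.mul_assoc,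
          Matrix.mul_nonsing_inv _ hS', Matrix.one_mul] }
  let D : Matrix (Fin l × Fin m) (Fin l × Fin m) ℂ := Matrix.diagonal (fun p => d p.1 - e p.2)
  have key : (sylv (S * Matrix.diagonal d * S⁻¹) (T * Matrix.diagonal e * T⁻¹)) ∘ₗ Φ.toLinearMap
      = Φ.toLinearMap ∘ₗ D.mulVecLin := by
    apply LinearMap.ext
    intro f
    change (S * Matrix.diagonal d * S⁻¹) * (S * Matrix.of (fun i j => f (i, j)) * T⁻¹)
      - (S * Matrix.of (fun i j => f (i, j)) * T⁻¹) * (T * Matrix.diagonal e * T⁻¹)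
      = S * Matrix.of (fun i j => (D.mulVec f) (i, j)) * T⁻¹
    have h : Matrix.of (fun i j => (D.mulVec f) (i, j))
        = Matrix.diagonal d * Matrix.of (fun i j => f (i, j))
          - Matrix.of (fun i j => f (i, j)) * Matrix.diagonal e := by
      ext i j
      simp [D, Matrix.mulVec_diagonal]
      ring
    rw [h, Matrix.mul_sub, Matrix.sub_mul]
    simp only [Matrix.mul_assoc]
    rw [Matrix.nonsing_inv_mul_cancel_left _ _ hS', Matrix.nonsing_inv_mul_cancel_left _ _ hT']
  have hr : LinearMap.range (sylv (S * Matrix.diagonal d * S⁻¹) (T * Matrix.diagonal e * T⁻¹))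
      = (LinearMap.range D.mulVecLin).map Φ.toLinearMap := by
    rw [← LinearMap.range_comp, ← key, LinearMap.range_comp, LinearEquiv.range, Submodule.map_top]
  unfold sDim
  rw [hr, LinearEquiv.finrank_map_eq]
  change D.rank = _
  rw [Matrix.rank_diagonal, Fintype.card_subtype]
  simp only [sub_ne_zero]

/-- The image of the Sylvester map `X ↦ PX - XR` for diagonalizable `P`, `R` has
dimension `lm - Σ_λ m_P(λ) m_R(λ)`. -/
theorem stmt14 (l m : ℕ)
    (P : Matrix (Fin l) (Fin l) ℂ) (R : Matrix (Fin m) (Fin m) ℂ)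
    (hP : IsDiagble P) (hR : IsDiagble R) :
    sDim P R = l * m - ∑ᶠ μ : ℂ, multOf P μ * multOf R μ := by
  obtain ⟨S, hS, d, rfl⟩ := hP
  obtain ⟨T, hT, e, rfl⟩ := hR
  rw [sDim_diag S hS d T hT e]
  simp only [multOf_diag S hS d, multOf_diag T hT e]
  have hsum : ∑ᶠ μ : ℂ, (Finset.univ.filter (fun i => d i = μ)).card
      * (Finset.univ.filter (fun j => e j = μ)).card
      = (Finset.univ.filter (fun p : Fin l × Fin m => d p.1 = e p.2)).card := by
    rw [finsum_eq_sum_of_support_subset (s := Finset.univ.image d)]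
    · rw [Finset.card_eq_sum_card_fiberwise (f := fun p : Fin l × Fin m => d p.1)
        (t := Finset.univ.image d)]
      · refine Finset.sum_congr rfl fun μ _ => ?_
        rw [← Finset.card_product]
        congr 1
        ext ⟨i, j⟩
        simp only [Finset.mem_product, Finset.mem_filter, Finset.mem_univ, true_and]
        constructor
        · rintro ⟨h1, h2⟩
          exact ⟨h1.trans h2.symm, h1⟩
        · rintro ⟨h1, h2⟩
          exact ⟨h2, h1.symm.trans h2⟩
      · intro p _
        simp
    · intro μ hμ
      have h1 := left_ne_zero_of_mul (Function.mem_support.1 hμ)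
      obtain ⟨i, hi⟩ := Finset.card_pos.1 (Nat.pos_of_ne_zero h1)
      simp only [Finset.mem_filter, Finset.mem_univ, true_and] at hi
      simp only [Finset.coe_image, Finset.coe_univ, Set.image_univ]
      exact ⟨i, hi⟩
  rw [hsum]
  have hc := Finset.card_filter_add_card_filter_not
    (s := (Finset.univ : Finset (Fin l × Fin m))) (fun p => d p.1 = e p.2)
  simp only [Finset.card_univ, Fintype.card_prod, Fintype.card_fin, ne_eq] at hc ⊢
  omega
end

section
/- Let P ∈ M_l(ℂ) and R ∈ M_m(ℂ) be diagonalizable matrices, and let s := dim_ℂ{PX − XR : X ∈ M_{l×m}(ℂ)} be the dimension of the image of the Sylvester map. Then s ≥ r(P)·m and s ≥ r(R)·l, where r(Y) := min over λ ∈ ℂ of rank(Y − λI). -/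
open Polynomial BigOperators

theorem rk_le_card {n : ℕ} (S : Matrix (Fin n) (Fin n) ℂ) (hS : IsUnit S) (d : Fin n → ℂ) (μ : ℂ) :
    rk (S * Matrix.diagonal d * S⁻¹) ≤ (Finset.univ.filter fun i => d i ≠ μ).card := by
  classical
  have hdet : IsUnit S.det := (Matrix.isUnit_iff_isUnit_det S).1 hS
  have hdet' : IsUnit (S⁻¹).det := by
    rw [Matrix.det_nonsing_inv]; exact hdet.ringInverse
  refine (ciInf_le (OrderBot.bddBelow _) μ).trans ?_
  have h : S * Matrix.diagonal d * S⁻¹ - μ • (1 : Matrix (Fin n) (Fin n) ℂ)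
      = S * Matrix.diagonal (fun i => d i - μ) * S⁻¹ := by
    have h1 : Matrix.diagonal (fun i => d i - μ)
        = Matrix.diagonal d - μ • (1 : Matrix (Fin n) (Fin n) ℂ) := by
      rw [Matrix.smul_one_eq_diagonal, Matrix.diagonal_sub]
    rw [h1, Matrix.mul_sub, Matrix.sub_mul]
    simp [Matrix.mul_nonsing_inv S hdet]
  rw [h, Matrix.rank_mul_eq_left_of_isUnit_det _ _ hdet',
    Matrix.rank_mul_eq_right_of_isUnit_det _ _ hdet, Matrix.rank_diagonal, Fintype.card_subtype]
  simp [sub_eq_zero]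

theorem sDim_eq {l m : ℕ} (S : Matrix (Fin l) (Fin l) ℂ) (hS : IsUnit S) (d : Fin l → ℂ)
    (T : Matrix (Fin m) (Fin m) ℂ) (hT : IsUnit T) (e : Fin m → ℂ) :
    sDim (S * Matrix.diagonal d * S⁻¹) (T * Matrix.diagonal e * T⁻¹)
      = (Finset.univ.filter fun p : Fin l × Fin m => d p.1 ≠ e p.2).card := by
  classical
  have hS1 := Matrix.mul_nonsing_inv S ((Matrix.isUnit_iff_isUnit_det S).1 hS)
  have hS2 := Matrix.nonsing_inv_mul S ((Matrix.isUnit_iff_isUnit_det S).1 hS)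
  have hT1 := Matrix.mul_nonsing_inv T ((Matrix.isUnit_iff_isUnit_det T).1 hT)
  have hT2 := Matrix.nonsing_inv_mul T ((Matrix.isUnit_iff_isUnit_det T).1 hT)
  let E : (Fin l × Fin m → ℂ) ≃ₗ[ℂ] Matrix (Fin l) (Fin m) ℂ :=
    { toFun := fun v => S * (Matrix.of fun i j => v (i, j)) * T⁻¹
      map_add' := by
        intro v w
        rw [← Matrix.add_mul, ← Matrix.mul_add]; rfl
      map_smul' := by
        intro c v
        rw [RingHom.id_apply, ← Matrix.smul_mul, ← Matrix.mul_smul]; rfl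
      invFun := fun Z p => (S⁻¹ * Z * T) p.1 p.2
      left_inv := by
        intro v
        funext p
        have : S⁻¹ * (S * (Matrix.of fun i j => v (i, j)) * T⁻¹) * T
            = Matrix.of fun i j => v (i, j) := by
          calc _ = (S⁻¹ * S) * (Matrix.of fun i j => v (i, j)) * (T⁻¹ * T) := by
                simp only [Matrix.mul_assoc]
            _ = _ := by rw [hS2, hT2, Matrix.one_mul, Matrix.mul_one]
        exact congrFun (congrFun this p.1) p.2
      right_inv := by
        intro Z
        change S * (S⁻¹ * Z * T) * T⁻¹ = Z
        calc _ = (S * S⁻¹) * Z * (T * T⁻¹) := by simp only [Matrix.mul_assoc]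
            _ = _ := by rw [hS1, hT1, Matrix.one_mul, Matrix.mul_one] }
  let w : Fin l × Fin m → ℂ := fun p => d p.1 - e p.2
  have key : sylv (S * Matrix.diagonal d * S⁻¹) (T * Matrix.diagonal e * T⁻¹) ∘ₗ
      (E : (Fin l × Fin m → ℂ) →ₗ[ℂ] Matrix (Fin l) (Fin m) ℂ)
      = (E : (Fin l × Fin m → ℂ) →ₗ[ℂ] Matrix (Fin l) (Fin m) ℂ) ∘ₗ
        (Matrix.diagonal w).mulVecLin := by
    refine LinearMap.ext fun v => ?_
    change (S * Matrix.diagonal d * S⁻¹) * (S * (Matrix.of fun i j => v (i, j)) * T⁻¹)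
      - (S * (Matrix.of fun i j => v (i, j)) * T⁻¹) * (T * Matrix.diagonal e * T⁻¹)
      = S * (Matrix.of fun i j => ((Matrix.diagonal w).mulVec v) (i, j)) * T⁻¹
    have h0 : (Matrix.of fun i j => ((Matrix.diagonal w).mulVec v) (i, j))
        = Matrix.diagonal d * (Matrix.of fun i j => v (i, j))
          - (Matrix.of fun i j => v (i, j)) * Matrix.diagonal e := by
      ext i j
      simp [Matrix.mulVec_diagonal, w, Matrix.diagonal_mul, Matrix.mul_diagonal]
      ring
    rw [h0, Matrix.mul_sub, Matrix.sub_mul]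
    generalize (Matrix.of fun i j => v (i, j)) = V
    congr 1
    · calc _ = S * Matrix.diagonal d * (S⁻¹ * S) * V * T⁻¹ := by simp only [Matrix.mul_assoc]
        _ = _ := by rw [hS2]; simp only [Matrix.mul_assoc, Matrix.one_mul]
    · calc _ = S * V * (T⁻¹ * T) * Matrix.diagonal e * T⁻¹ := by simp only [Matrix.mul_assoc]
        _ = _ := by rw [hT2]; simp only [Matrix.mul_assoc, Matrix.one_mul]
  have hr : LinearMap.range (sylv (S * Matrix.diagonal d * S⁻¹) (T * Matrix.diagonal e * T⁻¹))
      = (LinearMap.range (Matrix.diagonal w).mulVecLin).map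
        (E : (Fin l × Fin m → ℂ) →ₗ[ℂ] Matrix (Fin l) (Fin m) ℂ) := by
    rw [← LinearMap.range_comp, ← key, LinearMap.range_comp, LinearEquiv.range,
      Submodule.map_top]
  have hd : (Matrix.diagonal w).rank = Fintype.card {i // w i ≠ 0} := Matrix.rank_diagonal w
  unfold sDim
  rw [hr, LinearEquiv.finrank_map_eq]
  change (Matrix.diagonal w).rank = _
  rw [hd, Fintype.card_subtype]
  simp [w, sub_eq_zero]

/-- Lower bounds for the dimension of the image of the Sylvester map:
`s ≥ r(P)·m` and `s ≥ r(R)·l`. -/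
theorem stmt15 (l m : ℕ)
    (P : Matrix (Fin l) (Fin l) ℂ) (R : Matrix (Fin m) (Fin m) ℂ)
    (hP : IsDiagble P) (hR : IsDiagble R) :
    rk P * m ≤ sDim P R ∧ rk R * l ≤ sDim P R := by
  classical
  obtain ⟨S, hS, d, rfl⟩ := hP
  obtain ⟨T, hT, e, rfl⟩ := hR
  rw [sDim_eq S hS d T hT e]
  constructor
  · have h : (Finset.univ.filter fun p : Fin l × Fin m => d p.1 ≠ e p.2).card
        = ∑ j : Fin m, (Finset.univ.filter fun i => d i ≠ e j).card := by
      simp only [Finset.card_filter]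
      rw [Fintype.sum_prod_type_right]
    rw [h]
    calc _ = ∑ j : Fin m, rk (S * Matrix.diagonal d * S⁻¹) := by simp [mul_comm]
      _ ≤ _ := Finset.sum_le_sum fun j _ => rk_le_card S hS d (e j)
  · have h : (Finset.univ.filter fun p : Fin l × Fin m => d p.1 ≠ e p.2).card
        = ∑ i : Fin l, (Finset.univ.filter fun j => e j ≠ d i).card := by
      simp only [Finset.card_filter]
      rw [Fintype.sum_prod_type]
      simp only [ne_comm]
    rw [h]
    calc _ = ∑ i : Fin l, rk (T * Matrix.diagonal e * T⁻¹) := by simp [mul_comm]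
      _ ≤ _ := Finset.sum_le_sum fun i _ => rk_le_card T hT e (d i)
end

section
/- In the semi-direct setting (see context), suppose there is an index j ≥ 2 such that either (r(P_j) = 0 and r(R_j) > 0), or (r(P_j) > 0 and r(R_j) = 0), or (P_j = aI_l and R_j = bI_m with a ≠ b). Then s_1 + ⋯ + s_{p+1} ≥ 2lm + 2. -/
open Polynomial BigOperators

lemma rk_le {n : ℕ} (Y : Matrix (Fin n) (Fin n) ℂ) (μ : ℂ) :
    rk Y ≤ (Y - μ • (1 : Matrix (Fin n) (Fin n) ℂ)).rank :=
  Nat.sInf_le ⟨μ, rfl⟩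

lemma rk_att {n : ℕ} (Y : Matrix (Fin n) (Fin n) ℂ) :
    ∃ μ : ℂ, (Y - μ • (1 : Matrix (Fin n) (Fin n) ℂ)).rank = rk Y :=
  Nat.sInf_mem (Set.range_nonempty fun μ : ℂ => (Y - μ • (1 : Matrix (Fin n) (Fin n) ℂ)).rank)

lemma rank_add_ker {n k : ℕ} (A : Matrix (Fin n) (Fin k) ℂ) :
    A.rank + Module.finrank ℂ (LinearMap.ker A.mulVecLin) = k := by
  have := LinearMap.finrank_range_add_finrank_ker A.mulVecLin
  simpa [Matrix.rank] using this

lemma sDim_ge_aux {l m c : ℕ} (P : Matrix (Fin l) (Fin l) ℂ)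
    (S : Matrix (Fin m) (Fin m) ℂ) (hS : IsUnit S) (d : Fin m → ℂ)
    (h : ∀ k, c ≤ (P - d k • (1 : Matrix (Fin l) (Fin l) ℂ)).rank) :
    m * c ≤ sDim P (S * Matrix.diagonal d * S⁻¹) := by
  set R := S * Matrix.diagonal d * S⁻¹ with hR
  have hSS : S⁻¹ * S = 1 := Matrix.nonsing_inv_mul _ ((Matrix.isUnit_iff_isUnit_det _).1 hS)
  have hSS' : S * S⁻¹ = 1 := Matrix.mul_nonsing_inv _ ((Matrix.isUnit_iff_isUnit_det _).1 hS)
  have hRS : R * S = S * Matrix.diagonal d := by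
    rw [hR, Matrix.mul_assoc, hSS, Matrix.mul_one]
  have hmem : ∀ X : LinearMap.ker (sylv P R), ∀ k,
      (fun i => ((X : Matrix (Fin l) (Fin m) ℂ) * S) i k) ∈
        LinearMap.ker (P - d k • (1 : Matrix (Fin l) (Fin l) ℂ)).mulVecLin := by
    intro X k
    have hX : P * X.1 - X.1 * R = 0 := X.2
    have hX2 : P * (X.1 * S) = X.1 * S * Matrix.diagonal d := by
      rw [← Matrix.mul_assoc, sub_eq_zero.1 hX, Matrix.mul_assoc, hRS, ← Matrix.mul_assoc]
    rw [LinearMap.mem_ker, Matrix.mulVecLin_apply, Matrix.sub_mulVec, Matrix.smul_mulVec,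
      Matrix.one_mulVec]
    ext i
    have := congrFun (congrFun hX2 i) k
    rw [Matrix.mul_diagonal] at this
    have e : (P.mulVec fun i => (X.1 * S) i k) i = (P * (X.1 * S)) i k := rfl
    simp only [Pi.sub_apply, Pi.smul_apply, smul_eq_mul, Pi.zero_apply]
    rw [e, this]; ring
  let f : LinearMap.ker (sylv P R) →ₗ[ℂ]
      ((k : Fin m) → LinearMap.ker (P - d k • (1 : Matrix (Fin l) (Fin l) ℂ)).mulVecLin) :=
    { toFun := fun X k => ⟨_, hmem X k⟩
      map_add' := by
        intro X Y; ext k i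
        simp [Matrix.add_mul]
      map_smul' := by
        intro a X; ext k i
        simp }
  have hf : Function.Injective f := by
    intro X Y hXY
    have : X.1 * S = Y.1 * S := by
      ext i k
      exact congrFun (congrArg Subtype.val (congrFun hXY k)) i
    apply Subtype.ext
    calc X.1 = X.1 * S * S⁻¹ := by rw [Matrix.mul_assoc, hSS', Matrix.mul_one]
      _ = Y.1 := by rw [this, Matrix.mul_assoc, hSS', Matrix.mul_one]
  have h1 := LinearMap.finrank_le_finrank_of_injective hf
  rw [Module.finrank_pi_fintype] at h1
  have h2 := LinearMap.finrank_range_add_finrank_ker (sylv P R)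
  rw [Module.finrank_matrix] at h2
  simp only [Fintype.card_fin, Module.finrank_self, mul_one] at h2
  have h3 : ∑ k : Fin m, (c + Module.finrank ℂ
      (LinearMap.ker (P - d k • (1 : Matrix (Fin l) (Fin l) ℂ)).mulVecLin)) ≤ ∑ k : Fin m, l := by
    refine Finset.sum_le_sum fun k _ => ?_
    have := rank_add_ker (P - d k • (1 : Matrix (Fin l) (Fin l) ℂ))
    have := h k
    omega
  rw [Finset.sum_add_distrib] at h3
  simp only [Finset.sum_const, Finset.card_univ, Fintype.card_fin, smul_eq_mul] at h3
  have : m * l = l * m := mul_comm _ _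
  unfold sDim
  omega

lemma sDim_ge_left {l m : ℕ} (P : Matrix (Fin l) (Fin l) ℂ) (R : Matrix (Fin m) (Fin m) ℂ)
    (hR : IsDiagble R) : m * rk P ≤ sDim P R := by
  obtain ⟨S, hS, d, rfl⟩ := hR
  exact sDim_ge_aux P S hS d fun k => rk_le _ _

lemma rk_transpose {n : ℕ} (Y : Matrix (Fin n) (Fin n) ℂ) : rk Y.transpose = rk Y := by
  unfold rk
  congr 1; ext μ
  rw [← Matrix.rank_transpose]
  simp

lemma sDim_transpose {l m : ℕ} (P : Matrix (Fin l) (Fin l) ℂ) (R : Matrix (Fin m) (Fin m) ℂ) :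
    sDim R.transpose P.transpose ≤ sDim P R := by
  unfold sDim
  have : LinearMap.range (sylv R.transpose P.transpose) ≤
      (LinearMap.range (sylv P R)).map
        (Matrix.transposeLinearEquiv (Fin l) (Fin m) ℂ ℂ).toLinearMap := by
    rintro _ ⟨X, rfl⟩
    refine ⟨_, ⟨-X.transpose, rfl⟩, ?_⟩
    simp [sylv, Matrix.transpose_mul]
    abel
  exact (Submodule.finrank_mono this).trans (Submodule.finrank_map_le _ _)

lemma diag_transpose {n : ℕ} {Y : Matrix (Fin n) (Fin n) ℂ} (h : IsDiagble Y) :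
    IsDiagble Y.transpose := by
  obtain ⟨S, hS, d, rfl⟩ := h
  have hd : IsUnit S.transpose.det := by
    rw [Matrix.det_transpose]; exact (Matrix.isUnit_iff_isUnit_det _).1 hS
  have hu : IsUnit S.transpose := (Matrix.isUnit_iff_isUnit_det _).2 hd
  refine ⟨S.transpose⁻¹, Matrix.isUnit_nonsing_inv_iff.2 hu, d, ?_⟩
  rw [Matrix.nonsing_inv_nonsing_inv _ hd]
  simp [Matrix.transpose_mul, Matrix.transpose_nonsing_inv, Matrix.mul_assoc]

lemma sDim_ge_right {l m : ℕ} (P : Matrix (Fin l) (Fin l) ℂ) (R : Matrix (Fin m) (Fin m) ℂ)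
    (hP : IsDiagble P) : l * rk R ≤ sDim P R := by
  rw [← rk_transpose R]
  exact (sDim_ge_left _ _ (diag_transpose hP)).trans (sDim_transpose P R)

lemma common_ker {n : ℕ} {ι : Type*} (s : Finset ι) (A : ι → Matrix (Fin n) (Fin n) ℂ)
    (h : ∑ i ∈ s, (A i).rank < n) : ∃ u : Fin n → ℂ, u ≠ 0 ∧ ∀ i ∈ s, (A i).mulVec u = 0 := by
  classical
  have key : ∀ s : Finset ι, ∃ K : Submodule ℂ (Fin n → ℂ),
      (∀ u ∈ K, ∀ i ∈ s, (A i).mulVec u = 0) ∧ n ≤ Module.finrank ℂ K + ∑ i ∈ s, (A i).rank := by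
    intro s
    induction s using Finset.induction_on with
    | empty => exact ⟨⊤, by simp, by simp⟩
    | insert a s ha ih =>
      obtain ⟨K, hK, hn⟩ := ih
      refine ⟨K ⊓ LinearMap.ker (A a).mulVecLin, ?_, ?_⟩
      · intro u hu i hi
        rcases Finset.mem_insert.1 hi with rfl | hi
        · exact hu.2
        · exact hK u hu.1 i hi
      · rw [Finset.sum_insert ha]
        have h1 := Submodule.finrank_sup_add_finrank_inf_eq K (LinearMap.ker (A a).mulVecLin)
        have h2 := Submodule.finrank_le (K ⊔ LinearMap.ker (A a).mulVecLin)
        have h3 := rank_add_ker (A a)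
        simp only [Module.finrank_fin_fun] at h2
        omega
  obtain ⟨K, hK, hn⟩ := key s
  have hne : K ≠ ⊥ := by
    rintro rfl
    simp at hn
    omega
  obtain ⟨u, hu, hu0⟩ := Submodule.exists_mem_ne_zero_of_ne_bot hne
  exact ⟨u, hu0, hK u hu⟩

lemma sum_rk {n p : ℕ} (hn : 2 ≤ n) (A : Fin (p + 1) → Matrix (Fin n) (Fin n) ℂ)
    (hsum : ∑ j, A j = 0) (hc : TrivialCentralizer A) :
    n ≤ ∑ j ∈ Finset.univ.erase 0, rk (A j) := by
  by_contra! hlt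
  choose μ hμ using fun j => rk_att (A j)
  obtain ⟨u, hu0, hu⟩ := common_ker (Finset.univ.erase 0)
    (fun j => A j - μ j • (1 : Matrix (Fin n) (Fin n) ℂ)) (by simpa only [hμ] using hlt)
  obtain ⟨v, hv0, hv⟩ := common_ker (Finset.univ.erase 0)
    (fun j => (A j - μ j • (1 : Matrix (Fin n) (Fin n) ℂ)).transpose)
    (by simpa only [Matrix.rank_transpose, hμ] using hlt)
  have comm : ∀ j ∈ Finset.univ.erase 0,
      Matrix.vecMulVec u v * A j = A j * Matrix.vecMulVec u v := by
    intro j hj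
    have h1 : (A j).mulVec u = μ j • u := by
      have := hu j hj
      rwa [Matrix.sub_mulVec, Matrix.smul_mulVec, Matrix.one_mulVec, sub_eq_zero] at this
    have h2 : Matrix.vecMul v (A j) = μ j • v := by
      have := hv j hj
      rwa [Matrix.mulVec_transpose, Matrix.vecMul_sub, Matrix.vecMul_smul, Matrix.vecMul_one,
        sub_eq_zero] at this
    rw [Matrix.vecMulVec_mul, Matrix.mul_vecMulVec, h1, h2, Matrix.vecMulVec_smul,
      Matrix.smul_vecMulVec]
  have hA0 : A 0 = - ∑ j ∈ Finset.univ.erase 0, A j := by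
    rw [eq_neg_iff_add_eq_zero, Finset.add_sum_erase _ _ (Finset.mem_univ _), hsum]
  obtain ⟨c, hcc⟩ := hc (Matrix.vecMulVec u v) (by
    intro j
    by_cases hj : j = 0
    · subst hj
      rw [hA0, Matrix.mul_neg, Matrix.neg_mul, Finset.mul_sum, Finset.sum_mul,
        Finset.sum_congr rfl comm]
    · exact comm j (by simp [hj]))
  obtain ⟨a, ha⟩ := Function.ne_iff.1 hu0
  obtain ⟨b, hb⟩ := Function.ne_iff.1 hv0
  have hent : ∀ i k, u i * v k = if i = k then c else 0 := by
    intro i k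
    have := congrFun (congrFun hcc i) k
    simpa [Matrix.vecMulVec_apply, Matrix.one_apply] using this
  have hab := hent a b
  have hne : u a * v b ≠ 0 := mul_ne_zero ha hb
  have hab' : a = b := by
    by_contra h
    rw [if_neg h] at hab
    exact hne hab
  subst hab'
  have : ∃ k : Fin n, k ≠ a := by
    haveI : Nontrivial (Fin n) := Fin.nontrivial_iff_two_le.2 hn
    exact exists_ne a
  obtain ⟨k, hk⟩ := this
  rw [if_pos rfl] at hab
  have h1 := hent k k
  have h2 := hent a k
  rw [if_pos rfl, ← hab] at h1
  rw [if_neg hk.symm] at h2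
  have hvk : v k ≠ 0 := fun h => hne (by rw [← h1, h, mul_zero])
  exact (mul_ne_zero ha hvk) h2

/-- In the semi-direct setting, if for some `j ≥ 2` one of `r(P_j)`, `r(R_j)` vanishes
(the other being positive), or both blocks are scalar with distinct scalars, then
`s_1 + ⋯ + s_{p+1} ≥ 2lm + 2`. -/
theorem stmt16 (l m p : ℕ) (hm : 2 ≤ m) (hlm : m ≤ l) (hp : 1 ≤ p)
    (P : Fin (p + 1) → Matrix (Fin l) (Fin l) ℂ)
    (R : Fin (p + 1) → Matrix (Fin m) (Fin m) ℂ)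
    (hPdiag : ∀ j, IsDiagble (P j)) (hRdiag : ∀ j, IsDiagble (R j))
    (hPsum : ∑ j, P j = 0) (hRsum : ∑ j, R j = 0)
    (hPcent : TrivialCentralizer P) (hRcent : TrivialCentralizer R)
    (hPdist : HasDistinctEigenvalues (P 0)) (hRdist : HasDistinctEigenvalues (R 0))
    (hdisj : ∀ μ : ℂ, ¬((P 0 - μ • (1 : Matrix (Fin l) (Fin l) ℂ)).det = 0 ∧
        (R 0 - μ • (1 : Matrix (Fin m) (Fin m) ℂ)).det = 0))
    (hj : ∃ j : Fin (p + 1), j ≠ 0 ∧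
      ((rk (P j) = 0 ∧ 0 < rk (R j)) ∨ (0 < rk (P j) ∧ rk (R j) = 0) ∨
        (∃ a b : ℂ, a ≠ b ∧ P j = a • (1 : Matrix (Fin l) (Fin l) ℂ) ∧
          R j = b • (1 : Matrix (Fin m) (Fin m) ℂ)))) :
    2 * l * m + 2 ≤ ∑ j, sDim (P j) (R j) := by
  obtain ⟨j, hj0, hj⟩ := hj
  -- the term at index zero
  have h0 : l * m ≤ sDim (P 0) (R 0) := by
    obtain ⟨S, hS, d, hR⟩ := hRdiag 0
    rw [hR, mul_comm]
    refine sDim_ge_aux _ S hS d fun k => ?_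
    have hSd := (Matrix.isUnit_iff_isUnit_det _).1 hS
    have hdet : (R 0 - d k • (1 : Matrix (Fin m) (Fin m) ℂ)).det = 0 := by
      have e : R 0 - d k • (1 : Matrix (Fin m) (Fin m) ℂ) =
          S * Matrix.diagonal (fun i => d i - d k) * S⁻¹ := by
        have : Matrix.diagonal (fun i => d i - d k) =
            Matrix.diagonal d - d k • (1 : Matrix (Fin m) (Fin m) ℂ) := by
          ext a b
          by_cases hab : a = b <;> simp [hab]
        rw [this, Matrix.mul_sub, Matrix.sub_mul, hR, Matrix.mul_smul, Matrix.mul_one,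
          Matrix.smul_mul, Matrix.mul_nonsing_inv _ hSd]
      rw [e, Matrix.det_mul, Matrix.det_mul, Matrix.det_diagonal,
        Finset.prod_eq_zero (Finset.mem_univ k) (sub_self _)]
      simp
    have hP : (P 0 - d k • (1 : Matrix (Fin l) (Fin l) ℂ)).det ≠ 0 :=
      fun h => hdisj _ ⟨h, hdet⟩
    have hu : IsUnit (P 0 - d k • (1 : Matrix (Fin l) (Fin l) ℂ)) :=
      (Matrix.isUnit_iff_isUnit_det _).2 (isUnit_iff_ne_zero.2 hP)
    rw [Matrix.rank_of_isUnit _ hu, Fintype.card_fin]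
  have hjm : j ∈ Finset.univ.erase (0 : Fin (p + 1)) := by simp [hj0]
  rw [← Finset.add_sum_erase _ _ (Finset.mem_univ (0 : Fin (p + 1))),
    ← Finset.add_sum_erase _ _ hjm]
  have restP : rk (P j) = 0 →
      l * m ≤ ∑ i ∈ (Finset.univ.erase (0 : Fin (p + 1))).erase j, sDim (P i) (R i) := by
    intro hz
    have h1 := sum_rk (hm.trans hlm) P hPsum hPcent
    rw [← Finset.add_sum_erase _ _ hjm, hz, zero_add] at h1
    calc l * m = m * l := mul_comm _ _
      _ ≤ _ := Nat.mul_le_mul_left m h1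
      _ ≤ _ := by
        rw [Finset.mul_sum]
        exact Finset.sum_le_sum fun i _ => sDim_ge_left _ _ (hRdiag i)
  have restR : rk (R j) = 0 →
      l * m ≤ ∑ i ∈ (Finset.univ.erase (0 : Fin (p + 1))).erase j, sDim (P i) (R i) := by
    intro hz
    have h1 := sum_rk hm R hRsum hRcent
    rw [← Finset.add_sum_erase _ _ hjm, hz, zero_add] at h1
    calc l * m ≤ _ := Nat.mul_le_mul_left l h1
      _ ≤ _ := by
        rw [Finset.mul_sum]
        exact Finset.sum_le_sum fun i _ => sDim_ge_right _ _ (hPdiag i)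
  rw [mul_assoc]
  rcases hj with ⟨h1, h2⟩ | ⟨h1, h2⟩ | ⟨a, b, hab, hPa, hRb⟩
  · have := restP h1
    have h3 := sDim_ge_right (P j) (R j) (hPdiag j)
    have h4 : l ≤ l * rk (R j) := Nat.le_mul_of_pos_right _ h2
    omega
  · have := restR h2
    have h3 := sDim_ge_left (P j) (R j) (hRdiag j)
    have h4 : m ≤ m * rk (P j) := Nat.le_mul_of_pos_right _ h1
    omega
  · have h1 : rk (P j) = 0 := by
      have := rk_le (P j) a
      rw [hPa, sub_self, Matrix.rank_zero] at this
      rw [hPa]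
      omega
    have := restP h1
    have h3 : m * l ≤ sDim (P j) (R j) := by
      have e : R j = 1 * Matrix.diagonal (fun _ => b) * 1⁻¹ := by
        rw [hRb]
        simp [Matrix.smul_one_eq_diagonal]
      rw [e]
      refine sDim_ge_aux _ 1 isUnit_one _ fun k => ?_
      rw [hPa, ← sub_smul]
      have hu : IsUnit ((a - b) • (1 : Matrix (Fin l) (Fin l) ℂ)) := by
        rw [Matrix.isUnit_iff_isUnit_det, Matrix.det_smul, Matrix.det_one, mul_one]
        exact (isUnit_iff_ne_zero.2 (pow_ne_zero _ (sub_ne_zero.2 hab)))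
      rw [Matrix.rank_of_isUnit _ hu, Fintype.card_fin]
    have h4 : 2 * 1 ≤ m * l := Nat.mul_le_mul hm (by omega)
    omega
end

section
/- In the semi-direct setting (see context), suppose p ≥ 3 and that r(P_j) > 0 and r(R_j) > 0 for all j ≥ 2. Then s_1 + ⋯ + s_{p+1} ≥ 2lm + 2. -/
open Polynomial BigOperators

lemma aux_rank {l m : ℕ} (S : Matrix (Fin l) (Fin l) ℂ) (T : Matrix (Fin m) (Fin m) ℂ)
    (hS : IsUnit S) (hT : IsUnit T) (d : Fin l → ℂ) (e : Fin m → ℂ) :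
    sDim (S * Matrix.diagonal d * S⁻¹) (T * Matrix.diagonal e * T⁻¹)
      = Fintype.card {x : Fin l × Fin m // d x.1 - e x.2 ≠ 0} := by
  have hSd := (Matrix.isUnit_iff_isUnit_det S).1 hS
  have hTd := (Matrix.isUnit_iff_isUnit_det T).1 hT
  let Φ : (Fin l × Fin m → ℂ) →ₗ[ℂ] Matrix (Fin l) (Fin m) ℂ :=
    { toFun := fun v => S * (Matrix.of fun i k => v (i, k)) * T⁻¹
      map_add' := by
        intro v w
        rw [← Matrix.add_mul, ← Matrix.mul_add]; rfl
      map_smul' := by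
        intro c v
        rw [RingHom.id_apply, ← Matrix.smul_mul, ← Matrix.mul_smul]; rfl }
  have hΦ : ∀ v, Φ v = S * (Matrix.of fun i k => v (i, k)) * T⁻¹ := fun _ => rfl
  have hinj : Function.Injective Φ := by
    intro v w h
    rw [hΦ, hΦ] at h
    have h2 : S⁻¹ * (S * (Matrix.of fun i k => v (i, k)) * T⁻¹) * T
        = S⁻¹ * (S * (Matrix.of fun i k => w (i, k)) * T⁻¹) * T := by rw [h]
    simp only [Matrix.mul_assoc, Matrix.nonsing_inv_mul _ hTd, Matrix.mul_one] at h2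
    simp only [← Matrix.mul_assoc, Matrix.nonsing_inv_mul _ hSd, Matrix.one_mul] at h2
    funext x
    exact congrFun (congrFun h2 x.1) x.2
  have hsurj : Function.Surjective Φ := by
    intro Z
    refine ⟨fun x => (S⁻¹ * Z * T) x.1 x.2, ?_⟩
    rw [hΦ]
    have : (Matrix.of fun i k => (S⁻¹ * Z * T) i k) = S⁻¹ * Z * T := rfl
    simp only [this]
    simp only [Matrix.mul_assoc, Matrix.mul_nonsing_inv _ hTd, Matrix.mul_one]
    simp only [← Matrix.mul_assoc, Matrix.mul_nonsing_inv _ hSd, Matrix.one_mul]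
  let w : Fin l × Fin m → ℂ := fun x => d x.1 - e x.2
  have key : (sylv (S * Matrix.diagonal d * S⁻¹) (T * Matrix.diagonal e * T⁻¹)) ∘ₗ Φ
      = Φ ∘ₗ (Matrix.diagonal w).mulVecLin := by
    apply LinearMap.ext
    intro v
    simp only [LinearMap.comp_apply]
    have h1 : (Matrix.of fun i k => (Matrix.diagonal w).mulVecLin v (i, k))
        = Matrix.diagonal d * (Matrix.of fun i k => v (i, k))
          - (Matrix.of fun i k => v (i, k)) * Matrix.diagonal e := by
      ext i k
      simp [Matrix.mulVec_diagonal, Matrix.diagonal_mul, Matrix.mul_diagonal, w]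
      ring
    rw [hΦ ((Matrix.diagonal w).mulVecLin v), h1, hΦ]
    generalize (Matrix.of fun i k => v (i, k) : Matrix (Fin l) (Fin m) ℂ) = Y
    change S * Matrix.diagonal d * S⁻¹ * (S * Y * T⁻¹)
      - (S * Y * T⁻¹) * (T * Matrix.diagonal e * T⁻¹) = _
    have e1 : ∀ X : Matrix (Fin l) (Fin m) ℂ, S⁻¹ * (S * X) = X := fun X => by
      rw [← Matrix.mul_assoc, Matrix.nonsing_inv_mul _ hSd, Matrix.one_mul]
    have e2 : ∀ X : Matrix (Fin m) (Fin m) ℂ, T⁻¹ * (T * X) = X := fun X => by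
      rw [← Matrix.mul_assoc, Matrix.nonsing_inv_mul _ hTd, Matrix.one_mul]
    simp only [Matrix.mul_assoc, e1, e2, Matrix.mul_sub, Matrix.sub_mul]
  have hr : LinearMap.range (sylv (S * Matrix.diagonal d * S⁻¹) (T * Matrix.diagonal e * T⁻¹))
      = (LinearMap.range (Matrix.diagonal w).mulVecLin).map Φ := by
    rw [← LinearMap.range_comp, ← key, LinearMap.range_comp, LinearMap.range_eq_top.2 hsurj,
      Submodule.map_top]
  have hd := Matrix.rank_diagonal w
  unfold sDim
  rw [hr, ← (Submodule.equivMapOfInjective Φ hinj _).finrank_eq]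
  exact hd

/-- number of pairs with equal values -/
noncomputable def nEq {l m : ℕ} (d : Fin l → ℂ) (e : Fin m → ℂ) : ℕ :=
  ∑ i, ∑ k, if d i = e k then 1 else 0

lemma aux_card {l m : ℕ} (d : Fin l → ℂ) (e : Fin m → ℂ) :
    Fintype.card {x : Fin l × Fin m // d x.1 - e x.2 ≠ 0} + nEq d e = l * m := by
  classical
  have h1 : nEq d e = Fintype.card {x : Fin l × Fin m // d x.1 - e x.2 = 0} := by
    unfold nEq
    rw [← Fintype.sum_prod_type' (f := fun i k => if d i = e k then 1 else 0), Fintype.card_subtype]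
    simp [sub_eq_zero]
  have h2 := Fintype.card_subtype_compl (fun x : Fin l × Fin m => d x.1 - e x.2 = 0)
  have h3 := Fintype.card_subtype_le (fun x : Fin l × Fin m => d x.1 - e x.2 = 0)
  have h4 : Fintype.card (Fin l × Fin m) = l * m := by simp
  have h5 : Fintype.card {x : Fin l × Fin m // d x.1 - e x.2 ≠ 0}
      = Fintype.card {x : Fin l × Fin m // ¬ (d x.1 - e x.2 = 0)} := rfl
  omega

lemma nEq_fiber {l m : ℕ} (d : Fin l → ℂ) (e : Fin m → ℂ) (V : Finset ℂ) (hV : ∀ i, d i ∈ V) :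
    nEq d e = ∑ x ∈ V, (∑ i, if d i = x then 1 else 0) * (∑ k, if e k = x then 1 else 0) := by
  unfold nEq
  simp only [Finset.sum_mul_sum]
  rw [Finset.sum_comm (s := V)]
  refine Finset.sum_congr rfl fun i _ => ?_
  rw [Finset.sum_comm (s := V)]
  refine Finset.sum_congr rfl fun k _ => ?_
  rw [Finset.sum_eq_single (d i)]
  · simp [eq_comm]
  · intro b _ hb
    simp [Ne.symm hb]
  · intro h; exact absurd (hV i) h

lemma nEq_amgm {l m : ℕ} (d : Fin l → ℂ) (e : Fin m → ℂ) :
    2 * (l * m * nEq d e : ℤ) ≤ m ^ 2 * nEq d d + l ^ 2 * nEq e e := by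
  classical
  let V := Finset.univ.image d ∪ Finset.univ.image e
  have hd : ∀ i, d i ∈ V := by intro i; simp [V]
  have he : ∀ i, e i ∈ V := by intro i; simp [V]
  rw [nEq_fiber d e V hd, nEq_fiber d d V hd, nEq_fiber e e V he]
  push_cast
  simp only [Finset.mul_sum (s := V)]
  rw [← Finset.sum_add_distrib]
  refine Finset.sum_le_sum fun x _ => ?_
  generalize (∑ i, if d i = x then (1 : ℤ) else 0) = a
  generalize (∑ i, if e i = x then (1 : ℤ) else 0) = b
  nlinarith [sq_nonneg (m * a - l * b)]

lemma nEq_self_ge {l : ℕ} (d : Fin l → ℂ) : l ≤ nEq d d := by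
  unfold nEq
  calc l = ∑ i : Fin l, 1 := by simp
    _ ≤ _ := by
      refine Finset.sum_le_sum fun i _ => ?_
      have := Finset.single_le_sum (f := fun k => if d i = d k then 1 else 0)
        (fun _ _ => Nat.zero_le _) (Finset.mem_univ i)
      simpa using this

lemma nEq_self_le {l : ℕ} (d : Fin l → ℂ) (h : ∃ i k, d i ≠ d k) :
    nEq d d + (2 * l - 2) ≤ l * l := by
  classical
  obtain ⟨i0, k0, h⟩ := h
  have hb : nEq d d ≤ ∑ i, ∑ k, if (d i = d i0 ↔ d k = d i0) then 1 else 0 := by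
    unfold nEq
    refine Finset.sum_le_sum fun i _ => Finset.sum_le_sum fun k _ => ?_
    by_cases hik : d i = d k <;> simp [hik]
  have h2 : (∑ i, ∑ k, if (d i = d i0 ↔ d k = d i0) then 1 else 0) =
      (∑ i, if d i = d i0 then 1 else 0) * (∑ i, if d i = d i0 then 1 else 0) +
      (∑ i, if d i = d i0 then 0 else 1) * (∑ i, if d i = d i0 then 0 else 1) := by
    simp only [Finset.sum_mul_sum]
    rw [← Finset.sum_add_distrib]
    refine Finset.sum_congr rfl fun i _ => ?_
    rw [← Finset.sum_add_distrib]
    refine Finset.sum_congr rfl fun k _ => ?_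
    by_cases h1 : d i = d i0 <;> by_cases h2 : d k = d i0 <;> simp [h1, h2]
  have h3 : (∑ i, if d i = d i0 then 1 else 0) + (∑ i, if d i = d i0 then 0 else 1) = l := by
    rw [← Finset.sum_add_distrib]
    calc _ = ∑ i : Fin l, 1 := by
          refine Finset.sum_congr rfl fun i _ => ?_
          split_ifs <;> rfl
      _ = l := by simp
  have h4 : 1 ≤ (∑ i, if d i = d i0 then 1 else 0) := by
    have := Finset.single_le_sum (f := fun k => if d k = d i0 then 1 else 0)
        (fun _ _ => Nat.zero_le _) (Finset.mem_univ i0)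
    simpa using this
  have h5 : 1 ≤ (∑ i, if d i = d i0 then 0 else 1) := by
    have := Finset.single_le_sum (f := fun k => if d k = d i0 then 0 else 1)
        (fun _ _ => Nat.zero_le _) (Finset.mem_univ k0)
    simpa [Ne.symm h] using this
  rw [h2] at hb
  generalize (∑ i, if d i = d i0 then 1 else 0) = a at *
  generalize (∑ i, if d i = d i0 then 0 else 1) = b at *
  obtain ⟨a, rfl⟩ := Nat.exists_eq_add_of_le h4
  obtain ⟨b, rfl⟩ := Nat.exists_eq_add_of_le h5
  subst h3
  have : 2 * (1 + a + (1 + b)) - 2 = 2 * a + 2 * b + 2 := by omega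
  rw [this]
  nlinarith

lemma aux_cent {n q : ℕ} (A : Fin q → Matrix (Fin n) (Fin n) ℂ) (hs : ∑ j, A j = 0)
    (hc : TrivialCentralizer A) : 2 * n ^ 2 ≤ (∑ j, sDim (A j) (A j)) + 2 := by
  classical
  let C : Submodule ℂ (Matrix (Fin n) (Fin n) ℂ) := Submodule.span ℂ {1}
  have hC : Module.finrank ℂ C ≤ 1 := by
    have := finrank_span_le_card (R := ℂ) ({1} : Set (Matrix (Fin n) (Fin n) ℂ))
    simpa using this
  have hM : Module.finrank ℂ (Matrix (Fin n) (Fin n) ℂ) = n ^ 2 := by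
    simp [Module.finrank_matrix, sq]
  let φ : (Matrix (Fin n) (Fin n) ℂ) →ₗ[ℂ] (∀ j, LinearMap.range (sylv (A j) (A j))) :=
    LinearMap.pi fun j => (sylv (A j) (A j)).rangeRestrict
  let σ : (∀ j, LinearMap.range (sylv (A j) (A j))) →ₗ[ℂ] (Matrix (Fin n) (Fin n) ℂ) :=
    ∑ j, (LinearMap.range (sylv (A j) (A j))).subtype ∘ₗ LinearMap.proj j
  have hσ : ∀ u, σ u = ∑ j, (u j : (Matrix (Fin n) (Fin n) ℂ)) := by intro u; simp [σ]
  have hφ : ∀ X j, ((φ X j : (Matrix (Fin n) (Fin n) ℂ))) = A j * X - X * A j := by intro X j; rfl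
  have hker : LinearMap.ker φ ≤ C := by
    intro X hX
    rw [LinearMap.mem_ker] at hX
    obtain ⟨c, rfl⟩ := hc X (fun j => by
      have := hφ X j
      rw [hX] at this
      exact (sub_eq_zero.1 this.symm).symm)
    exact Submodule.smul_mem _ _ (Submodule.mem_span_singleton_self _)
  have hle : LinearMap.range φ ≤ LinearMap.ker σ := by
    rintro _ ⟨X, rfl⟩
    rw [LinearMap.mem_ker, hσ]
    simp only [hφ]
    rw [Finset.sum_sub_distrib, ← Finset.sum_mul, ← Finset.mul_sum, hs]
    simp
  let Ψ : (Matrix (Fin n) (Fin n) ℂ) →ₗ[ℂ] Module.Dual ℂ (Matrix (Fin n) (Fin n) ℂ) :=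
    LinearMap.mk₂ ℂ (fun Z X => Matrix.trace (Z * X))
      (by intro a b c; simp [Matrix.add_mul]) (by intro a b c; simp)
      (by intro a b c; simp [Matrix.mul_add]) (by intro a b c; simp)
  have hΨ : ∀ Z X, Ψ Z X = Matrix.trace (Z * X) := fun _ _ => rfl
  have hnd : ∀ Z : (Matrix (Fin n) (Fin n) ℂ), (∀ X : (Matrix (Fin n) (Fin n) ℂ), Matrix.trace (Z * X) = 0) → Z = 0 := by
    intro Z hZ
    ext i k
    have := hZ (Matrix.single k i 1)
    simpa [Matrix.trace_mul_single] using this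
  have hinj : Function.Injective Ψ := by
    rw [injective_iff_map_eq_zero]
    intro Z hZ
    refine hnd Z fun X => ?_
    rw [← hΨ, hZ]; rfl
  have hsurj : Function.Surjective Ψ :=
    (LinearMap.injective_iff_surjective_of_finrank_eq_finrank
      (Subspace.dual_finrank_eq (K := ℂ) (V := (Matrix (Fin n) (Fin n) ℂ))).symm).1 hinj
  have hann : (LinearMap.range σ).dualAnnihilator ≤ C.map Ψ := by
    intro f hf
    obtain ⟨Z, rfl⟩ := hsurj f
    refine ⟨Z, ?_, rfl⟩
    rw [Submodule.mem_dualAnnihilator] at hf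
    obtain ⟨c, rfl⟩ := hc Z (fun j => by
      rw [← sub_eq_zero]
      refine hnd _ fun X => ?_
      have h1 := hf (A j * X - X * A j) ⟨Pi.single j ⟨A j * X - X * A j, X, rfl⟩, by
        rw [hσ, Finset.sum_eq_single j]
        · simp
        · intro b _ hb; simp [hb]
        · simp⟩
      rw [hΨ, Matrix.mul_sub, Matrix.trace_sub] at h1
      rw [Matrix.sub_mul, Matrix.trace_sub, Matrix.mul_assoc, ← h1, Matrix.mul_assoc,
        Matrix.trace_mul_comm (A j), Matrix.mul_assoc])
    exact Submodule.smul_mem _ _ (Submodule.mem_span_singleton_self _)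
  have e1 := Subspace.finrank_add_finrank_dualAnnihilator_eq (LinearMap.range σ)
  have e2 := LinearMap.finrank_range_add_finrank_ker σ
  have e3 := LinearMap.finrank_range_add_finrank_ker φ
  have e4 := Submodule.finrank_mono hle
  have e5 := Submodule.finrank_mono hker
  have e6 := Submodule.finrank_mono hann
  have e7 := Submodule.finrank_map_le Ψ C
  have e8 : Module.finrank ℂ (∀ j, LinearMap.range (sylv (A j) (A j)))
      = ∑ j, sDim (A j) (A j) := by
    rw [Module.finrank_pi_fintype]; rfl
  omega

lemma aux_arith (l m A B T : ℕ) (hm : 2 ≤ m) (hlm : m ≤ l)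
    (h1 : m ^ 2 * A + l ^ 2 * B ≤ 2 * (l * m * T))
    (hA : l ^ 2 + l ≤ A + 2) (hB : m ^ 2 + m ≤ B + 2) (hA' : 6 * l ≤ A + 6)
    (hB' : 6 * m ≤ B + 6) : l * m + 2 ≤ T := by
  by_contra hT
  have hT' : T ≤ l * m + 1 := by omega
  have h2 : 2 * (l * m * T) ≤ 2 * (l * m * (l * m + 1)) := by gcongr
  have h3 := h1.trans h2
  have g1 : m ^ 2 * (l ^ 2 + l) ≤ m ^ 2 * (A + 2) := by gcongr
  have g2 : l ^ 2 * (m ^ 2 + m) ≤ l ^ 2 * (B + 2) := by gcongr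
  rcases Nat.lt_or_ge m 3 with hm3 | hm3
  · obtain rfl : m = 2 := by omega
    have g3 : l ^ 2 * 6 ≤ l ^ 2 * B := by gcongr; omega
    rcases Nat.lt_or_ge l 3 with hl | hl
    · obtain rfl : l = 2 := by omega
      omega
    · nlinarith
  · rcases Nat.lt_or_ge l 4 with hl | hl
    · obtain rfl : l = 3 := by omega
      obtain rfl : m = 3 := by omega
      omega
    · have g4 : l * m * (l + m) ≤ 2 * l * m + 2 * m ^ 2 + 2 * l ^ 2 := by nlinarith
      rcases Nat.lt_or_ge m 4 with hm4 | hm4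
      · obtain rfl : m = 3 := by omega
        nlinarith
      · nlinarith [Nat.mul_le_mul hm4 (le_refl (l * l)), Nat.mul_le_mul hm4 (le_refl (l * m)),
          Nat.mul_le_mul hlm hlm]

lemma aux_nonconst {n : ℕ} (S : Matrix (Fin n) (Fin n) ℂ) (hS : IsUnit S) (d : Fin n → ℂ)
    (h : 0 < rk (S * Matrix.diagonal d * S⁻¹)) : ∃ i k, d i ≠ d k := by
  by_contra hc
  push Not at hc
  have hSd := (Matrix.isUnit_iff_isUnit_det S).1 hS
  have : ∃ c : ℂ, Matrix.diagonal d = c • (1 : Matrix (Fin n) (Fin n) ℂ) := by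
    rcases Nat.eq_zero_or_pos n with rfl | hn
    · exact ⟨0, by ext i; exact i.elim0⟩
    · refine ⟨d ⟨0, hn⟩, ?_⟩
      rw [Matrix.smul_one_eq_diagonal]
      congr 1
      funext i
      exact hc _ _
  obtain ⟨c, hcd⟩ := this
  have h0 : rk (S * Matrix.diagonal d * S⁻¹) ≤ 0 := by
    unfold rk
    refine (ciInf_le (OrderBot.bddBelow _) c).trans ?_
    rw [hcd]
    simp [Matrix.mul_nonsing_inv _ hSd]
  omega

/-- In the semi-direct setting, if `p ≥ 3` and `r(P_j) > 0`, `r(R_j) > 0` for all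
`j ≥ 2`, then `s_1 + ⋯ + s_{p+1} ≥ 2lm + 2`. -/
theorem stmt17 (l m p : ℕ) (hm : 2 ≤ m) (hlm : m ≤ l) (hp : 3 ≤ p)
    (P : Fin (p + 1) → Matrix (Fin l) (Fin l) ℂ)
    (R : Fin (p + 1) → Matrix (Fin m) (Fin m) ℂ)
    (hPdiag : ∀ j, IsDiagble (P j)) (hRdiag : ∀ j, IsDiagble (R j))
    (hPsum : ∑ j, P j = 0) (hRsum : ∑ j, R j = 0)
    (hPcent : TrivialCentralizer P) (hRcent : TrivialCentralizer R)
    (hPdist : HasDistinctEigenvalues (P 0)) (hRdist : HasDistinctEigenvalues (R 0))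
    (hdisj : ∀ μ : ℂ, ¬((P 0 - μ • (1 : Matrix (Fin l) (Fin l) ℂ)).det = 0 ∧
        (R 0 - μ • (1 : Matrix (Fin m) (Fin m) ℂ)).det = 0))
    (hpos : ∀ j : Fin (p + 1), j ≠ 0 → 0 < rk (P j) ∧ 0 < rk (R j)) :
    2 * l * m + 2 ≤ ∑ j, sDim (P j) (R j) := by
  choose S hS d hd using hPdiag
  choose T hT e he using hRdiag
  have sPR : ∀ j, sDim (P j) (R j) + nEq (d j) (e j) = l * m := by
    intro j
    rw [hd j, he j, aux_rank _ _ (hS j) (hT j)]; exact aux_card _ _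
  have sPP : ∀ j, sDim (P j) (P j) + nEq (d j) (d j) = l * l := by
    intro j
    rw [hd j, aux_rank _ _ (hS j) (hS j)]; exact aux_card _ _
  have sRR : ∀ j, sDim (R j) (R j) + nEq (e j) (e j) = m * m := by
    intro j
    rw [he j, aux_rank _ _ (hT j) (hT j)]; exact aux_card _ _
  have hdet : ∀ {n : ℕ} (S : Matrix (Fin n) (Fin n) ℂ) (_ : IsUnit S) (d : Fin n → ℂ) (i : Fin n),
      (S * Matrix.diagonal d * S⁻¹ - d i • (1 : Matrix (Fin n) (Fin n) ℂ)).det = 0 := by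
    intro n S hS d i
    have hSd := (Matrix.isUnit_iff_isUnit_det S).1 hS
    have : S * Matrix.diagonal d * S⁻¹ - d i • (1 : Matrix (Fin n) (Fin n) ℂ)
        = S * (Matrix.diagonal (fun k => d k - d i)) * S⁻¹ := by
      have h1 : Matrix.diagonal (fun k => d k - d i)
          = Matrix.diagonal d - d i • (1 : Matrix (Fin n) (Fin n) ℂ) := by
        rw [Matrix.smul_one_eq_diagonal, Matrix.diagonal_sub]
      rw [h1, Matrix.mul_sub, Matrix.sub_mul]
      simp [Matrix.mul_nonsing_inv _ hSd]
    rw [this, Matrix.det_mul, Matrix.det_mul, Matrix.det_diagonal,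
      Finset.prod_eq_zero (Finset.mem_univ i) (sub_self _)]
    simp
  have s0 : sDim (P 0) (R 0) = l * m := by
    have hz : nEq (d 0) (e 0) = 0 := by
      unfold nEq
      refine Finset.sum_eq_zero fun i _ => Finset.sum_eq_zero fun k _ => ?_
      rw [if_neg]
      intro h
      refine hdisj (d 0 i) ⟨?_, ?_⟩
      · rw [hd 0]; exact hdet _ (hS 0) _ _
      · rw [he 0, h]; exact hdet _ (hT 0) _ _
    have := sPR 0
    omega
  have cP := aux_cent P hPsum hPcent
  have cR := aux_cent R hRsum hRcent
  have p0 := sPP 0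
  have r0 := sRR 0
  have p1 := nEq_self_ge (d 0)
  have r1 := nEq_self_ge (e 0)
  rw [Fin.sum_univ_succ] at cP cR ⊢
  have am : m ^ 2 * (∑ j : Fin p, sDim (P j.succ) (P j.succ))
      + l ^ 2 * (∑ j : Fin p, sDim (R j.succ) (R j.succ))
      ≤ 2 * (l * m * ∑ j : Fin p, sDim (P j.succ) (R j.succ)) := by
    simp only [Finset.mul_sum]
    rw [← Finset.sum_add_distrib]
    refine Finset.sum_le_sum fun j _ => ?_
    have a1 := sPR j.succ
    have a2 := sPP j.succ
    have a3 := sRR j.succ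
    have a4 := nEq_amgm (d j.succ) (e j.succ)
    zify at a1 a2 a3 ⊢
    rw [← eq_sub_iff_add_eq] at a1 a2 a3
    rw [a1, a2, a3]
    nlinarith
  have bP : p * (2 * l - 2) ≤ ∑ j : Fin p, sDim (P j.succ) (P j.succ) := by
    calc p * (2 * l - 2) = ∑ j : Fin p, (2 * l - 2) := by simp
      _ ≤ _ := by
        refine Finset.sum_le_sum fun j _ => ?_
        have h1 := (hpos j.succ (Fin.succ_ne_zero j)).1
        rw [hd] at h1
        have h2 := nEq_self_le _ (aux_nonconst _ (hS _) _ h1)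
        have := sPP j.succ
        omega
  have bR : p * (2 * m - 2) ≤ ∑ j : Fin p, sDim (R j.succ) (R j.succ) := by
    calc p * (2 * m - 2) = ∑ j : Fin p, (2 * m - 2) := by simp
      _ ≤ _ := by
        refine Finset.sum_le_sum fun j _ => ?_
        have h1 := (hpos j.succ (Fin.succ_ne_zero j)).2
        rw [he] at h1
        have h2 := nEq_self_le _ (aux_nonconst _ (hT _) _ h1)
        have := sRR j.succ
        omega
  have bP' := (Nat.mul_le_mul_right (2 * l - 2) hp).trans bP
  have bR' := (Nat.mul_le_mul_right (2 * m - 2) hp).trans bR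
  rw [← sq] at p0 r0
  have := aux_arith l m _ _ _ hm hlm am (by omega) (by omega) (by omega) (by omega)
  rw [s0]
  have h2 : 2 * l * m = l * m + l * m := by ring
  omega
end

section
/- Let n > 2 and p ≥ 1, and let c_1,…,c_{p+1} ⊂ gl(n,ℂ) be diagonalizable conjugacy classes, where c_1 has n distinct eigenvalues and r_2 + ⋯ + r_{p+1} = n. Suppose μ_1 is an eigenvalue of c_1 and, for each j ≥ 2, μ_j is an eigenvalue of c_j whose multiplicity is greater than n/2. Suppose Σ_{j=1}^{p+1} Σ_{k=1}^{n} λ_{k,j} = 0, that μ_1 + ⋯ + μ_{p+1} = 0, and that this is the only non-genericity relation satisfied by the eigenvalues: whenever subsets Φ_j ⊆ {1,…,n}, all of the same cardinality N with 1 ≤ N ≤ n−1, satisfy Σ_{j} Σ_{k∈Φ_j} λ_{k,j} = 0, then either N = 1 and for every j the unique index in Φ_j carries the eigenvalue μ_j, or N = n−1 and for every j the unique index outside Φ_j carries the eigenvalue μ_j. Then there exists NO irreducible tuple (A_1,…,A_{p+1}) with A_j ∈ c_j and A_1 + ⋯ + A_{p+1} = 0. -/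
open Polynomial BigOperators

lemma aux_conj {n : ℕ} {A B : Matrix (Fin n) (Fin n) ℂ} (h : SameClass A B) (c : ℂ) :
    (A - c • (1 : Matrix (Fin n) (Fin n) ℂ)).rank = (B - c • (1 : Matrix (Fin n) (Fin n) ℂ)).rank ∧
    (A - c • (1 : Matrix (Fin n) (Fin n) ℂ)).det = (B - c • (1 : Matrix (Fin n) (Fin n) ℂ)).det := by
  obtain ⟨S, hS, rfl⟩ := h
  have hd : IsUnit S.det := (Matrix.isUnit_iff_isUnit_det S).1 hS
  have e : S * B * S⁻¹ - c • (1 : Matrix (Fin n) (Fin n) ℂ)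
      = S * (B - c • (1 : Matrix (Fin n) (Fin n) ℂ)) * S⁻¹ := by
    rw [Matrix.mul_sub, Matrix.sub_mul]
    simp [Matrix.mul_nonsing_inv _ hd]
  have hd2 : IsUnit (S⁻¹).det := by
    simpa using Matrix.isUnit_nonsing_inv_det S hd
  rw [e]
  constructor
  · rw [Matrix.rank_mul_eq_left_of_isUnit_det _ _ hd2, Matrix.rank_mul_eq_right_of_isUnit_det _ _ hd]
  · exact Matrix.det_conj hS _

lemma aux_rk {n : ℕ} (B : Matrix (Fin n) (Fin n) ℂ) (m : ℂ) (h : n < 2 * multOf B m) :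
    (B - m • (1 : Matrix (Fin n) (Fin n) ℂ)).rank = rk B := by
  have key : ∀ c : ℂ, (B - c • (1 : Matrix (Fin n) (Fin n) ℂ)).rank + multOf B c = n := by
    intro c
    have := LinearMap.finrank_range_add_finrank_ker
      (B - c • (1 : Matrix (Fin n) (Fin n) ℂ)).mulVecLin
    simpa [Matrix.rank, multOf] using this
  unfold rk
  apply le_antisymm
  · apply le_ciInf
    intro c
    by_cases hc : c = m
    · rw [hc]
    · have hdis : Disjoint
          (LinearMap.ker (B - c • (1 : Matrix (Fin n) (Fin n) ℂ)).mulVecLin)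
          (LinearMap.ker (B - m • (1 : Matrix (Fin n) (Fin n) ℂ)).mulVecLin) := by
        rw [Submodule.disjoint_def]
        intro x hx hy
        simp only [LinearMap.mem_ker, Matrix.mulVecLin_apply, Matrix.sub_mulVec,
          Matrix.smul_mulVec, Matrix.one_mulVec] at hx hy
        have : (m - c) • x = 0 := by
          rw [sub_smul, ← sub_eq_zero.1 hx, ← sub_eq_zero.1 hy, sub_self]
        rcases smul_eq_zero.1 this with h1 | h1
        · exact absurd (sub_eq_zero.1 h1).symm hc
        · exact h1
      have h1 := Submodule.finrank_add_finrank_le_of_disjoint hdis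
      have h2 : multOf B c + multOf B m ≤ n := by simpa [multOf] using h1
      have := key c
      have := key m
      omega
  · exact ciInf_le (OrderBot.bddBelow _) m

/-- Example: diagonalizable classes with `r_2 + ⋯ + r_{p+1} = n`, eigenvalues `μ_j` of
large multiplicity, and a unique non-genericity relation `μ_1 + ⋯ + μ_{p+1} = 0`; then
no irreducible tuple with zero sum exists. -/
theorem stmt19 (n p : ℕ) (hn : 2 < n) (hp : 1 ≤ p)
    (B : Fin (p + 1) → Matrix (Fin n) (Fin n) ℂ)
    (hdiag : ∀ j, IsDiagble (B j))
    (lam : Fin n → Fin (p + 1) → ℂ)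
    (hchar : ∀ j, (B j).charpoly = ∏ k, (Polynomial.X - Polynomial.C (lam k j)))
    (hdist : Function.Injective fun k => lam k 0)
    (hr : ∑ j ∈ Finset.univ.erase 0, rk (B j) = n)
    (μ : Fin (p + 1) → ℂ)
    (hμ0 : ∃ k, lam k 0 = μ 0)
    (hμmult : ∀ j, j ≠ 0 → n < 2 * multOf (B j) (μ j))
    (htrace : ∑ j, ∑ k, lam k j = 0)
    (hμsum : ∑ j, μ j = 0)
    (honly : ∀ (N : ℕ) (Φ : Fin (p + 1) → Finset (Fin n)),
      1 ≤ N → N ≤ n - 1 → (∀ j, (Φ j).card = N) →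
      (∑ j, ∑ k ∈ Φ j, lam k j) = 0 →
      (N = 1 ∧ ∀ j, ∀ k ∈ Φ j, lam k j = μ j) ∨
        (N = n - 1 ∧ ∀ j, ∀ k ∉ Φ j, lam k j = μ j)) :
    ¬ ∃ A : Fin (p + 1) → Matrix (Fin n) (Fin n) ℂ,
        (∀ j, SameClass (A j) (B j)) ∧ ∑ j, A j = 0 ∧ IrreducibleTuple A := by
  rintro ⟨A, hA, hsum, hirr⟩
  let C : Fin (p + 1) → Matrix (Fin n) (Fin n) ℂ :=
    fun j => A j - μ j • (1 : Matrix (Fin n) (Fin n) ℂ)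
  have hAC : ∀ j v, (A j).mulVec v = (C j).mulVec v + μ j • v := by
    intro j v
    simp [C, Matrix.sub_mulVec, Matrix.smul_mulVec]
  have hCsum : C 0 + ∑ i : Fin p, C i.succ = 0 := by
    rw [← Fin.sum_univ_succ]
    simp only [C, Finset.sum_sub_distrib, ← Finset.sum_smul, hsum, hμsum]
    simp
  have hCv : ∀ v, (C 0).mulVec v = - ∑ i : Fin p, (C i.succ).mulVec v := by
    intro v
    rw [eq_neg_of_add_eq_zero_left hCsum, Matrix.neg_mulVec, Matrix.sum_mulVec]
  have hrank : ∑ i : Fin p, (C i.succ).rank = n := by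
    refine Eq.trans ?_ hr
    have h1 : ∑ j ∈ Finset.univ.erase (0 : Fin (p+1)), rk (B j) = ∑ i : Fin p, rk (B i.succ) := by
      have h2 := Finset.add_sum_erase Finset.univ (fun j => rk (B j)) (Finset.mem_univ (0 : Fin (p+1)))
      rw [Fin.sum_univ_succ] at h2
      exact Nat.add_left_cancel h2
    rw [h1]
    refine Finset.sum_congr rfl fun i _ => ?_
    rw [← aux_rk (B i.succ) (μ i.succ) (hμmult _ (Fin.succ_ne_zero i))]
    exact (aux_conj (hA _) _).1
  have hne : ¬ ∀ i : Fin p, ∀ v, (C i.succ).mulVec v = 0 := by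
    intro h
    have : ∀ i : Fin p, (C i.succ).rank = 0 := by
      intro i
      have : C i.succ = 0 := by
        apply Matrix.mulVec_injective
        funext v
        simp [h i v]
      rw [this, Matrix.rank_zero]
    simp [this] at hrank
    omega
  -- eigenvector of `A 0`
  obtain ⟨v, hv0, hv⟩ : ∃ v, v ≠ 0 ∧ (C 0).mulVec v = 0 := by
    rw [Matrix.exists_mulVec_eq_zero_iff]
    change (A 0 - μ 0 • (1 : Matrix (Fin n) (Fin n) ℂ)).det = 0
    rw [(aux_conj (hA 0) _).2]
    obtain ⟨k, hk⟩ := hμ0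
    have h1 : (B 0).charpoly.eval (μ 0) = 0 := by
      rw [hchar, Polynomial.eval_prod]
      exact Finset.prod_eq_zero (Finset.mem_univ k) (by simp [hk])
    rw [Matrix.eval_charpoly] at h1
    rw [← neg_sub, Matrix.det_neg, Matrix.smul_one_eq_diagonal]
    rw [Matrix.scalar_apply] at h1
    rw [h1, mul_zero]
  -- the images span
  let R : Fin p → Submodule ℂ (Fin n → ℂ) := fun i => LinearMap.range (C i.succ).mulVecLin
  have htop : (⨆ i, R i) = ⊤ := by
    have hmem : ∀ (i : Fin p) w, (C i.succ).mulVec w ∈ ⨆ i, R i := fun i w =>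
      (le_iSup R i) ⟨w, rfl⟩
    rcases hirr (⨆ i, R i) (by
      intro j w hw
      rw [hAC]
      refine Submodule.add_mem _ ?_ (Submodule.smul_mem _ _ hw)
      refine Fin.cases ?_ (fun i => hmem i w) j
      rw [hCv]
      exact Submodule.neg_mem _ (Submodule.sum_mem _ fun i _ => hmem i w)) with h | h
    · exfalso
      apply hne
      intro i w
      have := hmem i w
      rw [h] at this
      simpa using this
    · exact h
  let F : ((i : Fin p) → R i) →ₗ[ℂ] (Fin n → ℂ) :=
    LinearMap.lsum ℂ (fun i => R i) ℂ (fun i => (R i).subtype)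
  have hFapp : ∀ x, F x = ∑ i, (x i : Fin n → ℂ) := by
    intro x
    simp [F, LinearMap.lsum_apply]
  have hFsurj : Function.Surjective F := by
    rw [← LinearMap.range_eq_top, eq_top_iff, ← htop]
    refine iSup_le fun i w hw => ⟨Pi.single i ⟨w, hw⟩, ?_⟩
    rw [hFapp, Finset.sum_eq_single i]
    · simp
    · intro b _ hb
      rw [Pi.single_eq_of_ne hb]
      rfl
    · intro h
      exact absurd (Finset.mem_univ i) h
  have hFinj : Function.Injective F := by
    refine (LinearMap.injective_iff_surjective_of_finrank_eq_finrank ?_).2 hFsurj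
    rw [Module.finrank_pi_fintype, Module.finrank_fin_fun]
    exact hrank
  have hvk : ∀ i : Fin p, (C i.succ).mulVec v = 0 := by
    have h0 : F (fun i => ⟨(C i.succ).mulVec v, v, rfl⟩) = 0 := by
      rw [hFapp]
      have := hCv v
      rw [hv] at this
      exact neg_eq_zero.1 this.symm
    have h1 := hFinj (h0.trans (map_zero F).symm)
    intro i
    exact congrArg Subtype.val (congrFun h1 i)
  have hmemK : ∀ w, w ∈ (⨅ i : Fin p, LinearMap.ker (C i.succ).mulVecLin) ↔
      ∀ i : Fin p, (C i.succ).mulVec w = 0 := by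
    intro w
    simp [Submodule.mem_iInf]
  rcases hirr (⨅ i : Fin p, LinearMap.ker (C i.succ).mulVecLin) (by
    intro j w hw
    have hw' := (hmemK w).1 hw
    have : (C j).mulVec w = 0 := by
      refine Fin.cases ?_ (fun i => hw' i) j
      rw [hCv]
      simp [hw']
    rw [hAC, this, zero_add]
    exact Submodule.smul_mem _ _ hw) with h | h
  · apply hv0
    have := (hmemK v).2 hvk
    rw [h] at this
    simpa using this
  · apply hne
    intro i w
    exact (hmemK w).1 (by rw [h]; trivial) i
end
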